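/- Let L > 0 and T > 0. There exists a constant C > 0, depending only on L and T, such that the following holds. Let f : ℝ × ℝ → ℝ be continuous on [0,L]×[0,T], and let y : ℝ × ℝ → ℝ be such that y and its partial derivatives ∂_t y, ∂_x y, ∂_x² y, ∂_x³ y are continuous on [0,L]×[0,T], y satisfies y_t + y_x + y_{xxx} = f at every point of [0,L]×[0,T], and y(0,t) = 0, y_x(L,t) = 0, y_{xx}(L,t) = 0 for all t ∈ [0,T]. Then the hidden regularity estimate holds: for every x ∈ [0,L], ( ∫₀^T y_x(x,t)² dt )^{1/2} ≤ C [ ( ∫₀^L y(x,0)² dx )^{1/2} + ∫₀^T ( ∫₀^L f(x,t)² dx )^{1/2} dt ]. -/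

import Mathlib

open MeasureTheory Set

/-- Plancherel for compactly supported continuous functions. -/
lemma kdv_plancherel (h : ℝ → ℝ) (hh : Continuous h) (a b : ℝ) (hab : a < b) :
    ∫⁻ w : ℝ, ENNReal.ofReal (‖∫ t in a..b, Complex.exp (-(Complex.I * w * t)) * (h t : ℂ)‖ ^ 2)
      = ENNReal.ofReal (2 * Real.pi * ∫ t in a..b, h t ^ 2) := by
  have hP : 0 < b - a := by linarith
  have hpi := Real.pi_pos
  set q : ℝ := 2 * Real.pi / (b - a) with hq
  have hq0 : 0 < q := by positivity
  set F : ℝ → ENNReal := fun w =>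
    ENNReal.ofReal (‖∫ t in a..b, Complex.exp (-(Complex.I * w * t)) * (h t : ℂ)‖ ^ 2) with hF
  have hFc : Continuous F := by
    apply ENNReal.continuous_ofReal.comp
    apply Continuous.pow
    apply Continuous.norm
    apply intervalIntegral.continuous_parametric_intervalIntegral_of_continuous'
    simp only [Function.uncurry_def]
    fun_prop
  have key : ∀ th : ℝ, ∑' n : ℤ, F (n * q + th)
      = ENNReal.ofReal ((b - a) * ∫ t in a..b, h t ^ 2) := by
    intro th
    set g : ℝ → ℂ := fun t => Complex.exp (-(Complex.I * th * t)) * (h t : ℂ) with hg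
    have hgc : Continuous g := by fun_prop
    have hm : MemLp g 2 (volume.restrict (Ioc a b)) := by
      rw [memLp_two_iff_integrable_sq_norm hgc.aestronglyMeasurable]
      have : Continuous (fun x => ‖g x‖ ^ 2) := by fun_prop
      exact (this.integrableOn_Icc (a := a) (b := b)).mono_set Ioc_subset_Icc_self
    have hs := hasSum_sq_fourierCoeffOn hab hm
    have hco : ∀ n : ℤ, F (n * q + th)
        = ENNReal.ofReal ((b-a)^2 * ‖fourierCoeffOn hab g n‖ ^ 2) := by
      intro n
      rw [fourierCoeffOn_eq_integral, norm_smul, hF]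
      simp only
      congr 1
      rw [mul_pow, ← mul_assoc, ← mul_pow, Real.norm_of_nonneg (by positivity),
        mul_one_div_cancel hP.ne', one_pow, one_mul]
      congr 2
      apply intervalIntegral.integral_congr
      intro t _
      simp only [hg, fourier_coe_apply, smul_eq_mul]
      rw [← mul_assoc, ← Complex.exp_add]
      congr 2
      rw [hq]
      have : ((b:ℂ) - a) ≠ 0 := by exact_mod_cast hP.ne'
      push_cast
      field_simp
      ring
    have hn : ∀ t, ‖g t‖ ^ 2 = h t ^ 2 := by
      intro t
      rw [hg]; simp [Complex.norm_exp]
    simp_rw [hn] at hs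
    have hs2 := hs.mul_left ((b-a)^2)
    simp_rw [hco]
    rw [← ENNReal.ofReal_tsum_of_nonneg (fun n => by positivity) hs2.summable, hs2.tsum_eq]
    congr 1
    rw [smul_eq_mul]; field_simp
  have hfd := (isAddFundamentalDomain_Ioc hq0 0 (volume : Measure ℝ)).lintegral_eq_tsum'' F
  rw [show (∫⁻ w : ℝ, F w) = _ from hfd]
  rw [← lintegral_tsum (fun g => by
    apply Measurable.aemeasurable
    apply hFc.measurable.comp
    change Measurable (fun x : ℝ => (g:ℝ) + x)
    fun_prop)]
  have e : ∀ x : ℝ, ∑' g : AddSubgroup.zmultiples q, F (g +ᵥ x)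
      = ENNReal.ofReal ((b - a) * ∫ t in a..b, h t ^ 2) := by
    intro x
    rw [← key x]
    have hinj : Function.Injective (fun n : ℤ => n • q) := by
      intro m n hmn
      simpa [hq0.ne'] using hmn
    let eq : ℤ ≃ AddSubgroup.zmultiples q :=
      Equiv.ofBijective (fun n => ⟨n • q, n, rfl⟩)
        ⟨fun m n hmn => hinj (congrArg Subtype.val hmn), fun ⟨_, n, hn⟩ => ⟨n, Subtype.ext hn⟩⟩
    rw [← eq.tsum_eq]
    apply tsum_congr
    intro n
    have : (eq n +ᵥ x : ℝ) = n * q + x := by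
      change n • q + x = _
      simp
    rw [this]
  simp_rw [e]
  rw [setLIntegral_const, Real.volume_Ioc, ← ENNReal.ofReal_mul]
  · congr 1
    rw [hq]; field_simp; ring
  · apply mul_nonneg hP.le
    apply intervalIntegral.integral_nonneg hab.le
    intros; positivity

lemma kdv_gamma_int (c : ℝ) (hc : 0 < c) :
    ∫⁻ u : ℝ, ENNReal.ofReal (|u| ^ (-(1/2) : ℝ) * Real.exp (-(c * |u| / 2)))
      = ENNReal.ofReal (2 * (2 / c) ^ (1/2 : ℝ) * Real.Gamma (1/2)) := by
  have h1 := Real.integral_rpow_mul_exp_neg_mul_Ioi (a := 1/2) (r := c/2) (by norm_num) (by positivity)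
  have e1 : (1/2 - 1 : ℝ) = -(1/2) := by norm_num
  rw [e1] at h1
  have hpos : 0 < (1 / (c/2)) ^ (1/2 : ℝ) * Real.Gamma (1/2) :=
    mul_pos (Real.rpow_pos_of_pos (by positivity) _) (Real.Gamma_pos_of_pos (by norm_num))
  have hint : IntegrableOn (fun t : ℝ => t ^ (-(1/2):ℝ) * Real.exp (-(c/2*t))) (Ioi 0) := by
    by_contra hcon
    rw [integral_undef hcon] at h1
    linarith
  have h2 : ∫ u : ℝ, |u| ^ (-(1/2) : ℝ) * Real.exp (-(c * |u| / 2))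
      = 2 * ∫ u in Ioi (0:ℝ), u ^ (-(1/2) : ℝ) * Real.exp (-(c / 2 * u)) := by
    have := integral_comp_abs (f := fun u => u ^ (-(1/2) : ℝ) * Real.exp (-(c / 2 * u)))
    rw [← this]
    congr 1
    ext u
    congr 3
    ring
  have hint2 : Integrable (fun u : ℝ => |u| ^ (-(1/2) : ℝ) * Real.exp (-(c * |u| / 2))) := by
    by_contra hcon
    rw [integral_undef hcon, h1] at h2
    linarith
  rw [← ofReal_integral_eq_lintegral_ofReal hint2, h2, h1]
  · congr 1
    rw [one_div_div]; ring
  · filter_upwards with u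
    positivity

lemma kdv_cs {α : Type*} [MeasurableSpace α] (μ : Measure α) (f g : α → ENNReal)
    (hf : AEMeasurable f μ) (hg : AEMeasurable g μ) :
    (∫⁻ a, f a * g a ∂μ) ^ 2 ≤ (∫⁻ a, f a ^ 2 ∂μ) * ∫⁻ a, g a ^ 2 ∂μ := by
  have h := ENNReal.lintegral_mul_le_Lp_mul_Lq μ (p := 2) (q := 2)
    (by constructor <;> norm_num) hf hg
  have := pow_le_pow_left' h 2
  refine this.trans (le_of_eq ?_)
  rw [mul_pow, ← ENNReal.rpow_natCast, ← ENNReal.rpow_natCast, ← ENNReal.rpow_mul,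
    ← ENNReal.rpow_mul]
  norm_num

/-- Schur test for the Laplace-type kernel. -/
lemma kdv_schur : ∃ K : ℝ, 0 < K ∧ ∀ (L : ℝ), 0 < L → ∀ (g : ℝ → ℝ), Continuous g → ∀ x : ℝ,
    ∫⁻ k : ℝ, ENNReal.ofReal ((∫ ξ in (0:ℝ)..L, Real.exp (-(|k| * |x - ξ| / 2)) * |g ξ|) ^ 2)
      ≤ ENNReal.ofReal (K * ∫ ξ in (0:ℝ)..L, g ξ ^ 2) := by
  set G := 2 * (2:ℝ) ^ (1/2 : ℝ) * Real.Gamma (1/2) with hG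
  have hG0 : 0 < G := by
    have := Real.Gamma_pos_of_pos (s := 1/2) (by norm_num)
    positivity
  have hJ : ∀ c : ℝ, 0 < c →
    ∫⁻ u : ℝ, ENNReal.ofReal (|u| ^ (-(1/2) : ℝ) * Real.exp (-(c * |u| / 2)))
      = ENNReal.ofReal (G * c ^ (-(1/2) : ℝ)) := by
    intro c hc
    rw [kdv_gamma_int c hc, Real.div_rpow (by norm_num) hc.le, Real.rpow_neg hc.le, hG]
    congr 1
    ring
  refine ⟨G ^ 2, by positivity, ?_⟩
  intro L hL g hg x
  set μ := volume.restrict (Ioc (0:ℝ) L) with hμ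
  -- pointwise bound
  have hpt : ∀ k : ℝ, k ≠ 0 →
      ENNReal.ofReal ((∫ ξ in (0:ℝ)..L, Real.exp (-(|k| * |x - ξ| / 2)) * |g ξ|) ^ 2)
      ≤ ENNReal.ofReal (G * |k| ^ (-(1/2) : ℝ)) *
        ∫⁻ ξ, ENNReal.ofReal (Real.exp (-(|k| * |x - ξ| / 2)) * |x - ξ| ^ (1/2 : ℝ) * g ξ ^ 2) ∂μ := by
    intro k hk
    have hk0 : 0 < |k| := abs_pos.mpr hk
    set A : ℝ → ℝ := fun ξ => Real.exp (-(|k| * |x - ξ| / 4)) * |x - ξ| ^ (-(1/4) : ℝ) with hA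
    set B : ℝ → ℝ := fun ξ => Real.exp (-(|k| * |x - ξ| / 4)) * |x - ξ| ^ (1/4 : ℝ) * |g ξ| with hB
    have hAm : Measurable A := by
      rw [hA]; fun_prop
    have hBm : Measurable B := by
      have := hg.measurable
      rw [hB]; fun_prop
    rw [intervalIntegral.integral_of_le hL.le, ENNReal.ofReal_pow (by positivity),
      ofReal_integral_eq_lintegral_ofReal]
    rotate_left
    · have : Continuous (fun ξ => Real.exp (-(|k| * |x - ξ| / 2)) * |g ξ|) := by fun_prop
      exact this.integrableOn_Icc.mono_set Ioc_subset_Icc_self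
    · filter_upwards with ξ; positivity
    have hne : ∀ᵐ ξ ∂μ, ξ ≠ x := by
      apply ae_restrict_of_ae
      exact Measure.ae_ne volume x
    have e1 : ∫⁻ ξ, ENNReal.ofReal (Real.exp (-(|k| * |x - ξ| / 2)) * |g ξ|) ∂μ
        = ∫⁻ ξ, ENNReal.ofReal (A ξ) * ENNReal.ofReal (B ξ) ∂μ := by
      apply lintegral_congr_ae
      filter_upwards [hne] with ξ hξ
      have hp : 0 < |x - ξ| := abs_pos.mpr (sub_ne_zero.mpr (Ne.symm hξ))
      rw [← ENNReal.ofReal_mul (by positivity)]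
      congr 1
      rw [hA, hB]
      simp only
      have e2 : |x - ξ| ^ (-(1/4) : ℝ) * |x - ξ| ^ (1/4 : ℝ) = 1 := by
        rw [← Real.rpow_add hp]; norm_num
      have e3 : Real.exp (-(|k| * |x - ξ| / 2))
          = Real.exp (-(|k| * |x - ξ| / 4)) * Real.exp (-(|k| * |x - ξ| / 4)) := by
        rw [← Real.exp_add]; congr 1; ring
      rw [e3]
      linear_combination (-(Real.exp (-(|k| * |x - ξ| / 4)) * Real.exp (-(|k| * |x - ξ| / 4)) * |g ξ|)) * e2
    rw [e1]
    refine (kdv_cs μ _ _ hAm.ennreal_ofReal.aemeasurable hBm.ennreal_ofReal.aemeasurable).trans ?_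
    have e4 : ∀ ξ, Real.exp (-(|k| * |x - ξ| / 4)) ^ 2 = Real.exp (-(|k| * |x - ξ| / 2)) := by
      intro ξ
      rw [← Real.exp_nat_mul]; congr 1; push_cast; ring
    apply mul_le_mul'
    · rw [← hJ |k| hk0]
      calc ∫⁻ ξ, ENNReal.ofReal (A ξ) ^ 2 ∂μ ≤ ∫⁻ ξ, ENNReal.ofReal (A ξ) ^ 2 :=
            lintegral_mono' Measure.restrict_le_self le_rfl
        _ = ∫⁻ ξ, (fun u => ENNReal.ofReal (|u| ^ (-(1/2) : ℝ) * Real.exp (-(|k| * |u| / 2)))) (x - ξ) := by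
            apply lintegral_congr
            intro ξ
            rw [← ENNReal.ofReal_pow (by positivity)]
            simp only [hA]
            congr 1
            rw [mul_pow, e4, ← Real.rpow_natCast, ← Real.rpow_mul (abs_nonneg _)]
            norm_num [mul_comm]
        _ = _ := lintegral_sub_left_eq_self (μ := volume) (fun u => ENNReal.ofReal (|u| ^ (-(1/2) : ℝ) * Real.exp (-(|k| * |u| / 2)))) x
        _ ≤ _ := le_rfl
    · apply lintegral_mono
      intro ξ
      simp only
      rw [← ENNReal.ofReal_pow (by positivity)]
      apply ENNReal.ofReal_le_ofReal
      simp only [hB]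
      rw [mul_pow, mul_pow, e4, ← Real.rpow_natCast (|x - ξ| ^ (1/4 : ℝ)), ← Real.rpow_mul (abs_nonneg _), sq_abs]
      norm_num
  have hgm := hg.measurable
  calc _ ≤ ∫⁻ k : ℝ, ENNReal.ofReal (G * |k| ^ (-(1/2) : ℝ)) *
        ∫⁻ ξ, ENNReal.ofReal (Real.exp (-(|k| * |x - ξ| / 2)) * |x - ξ| ^ (1/2 : ℝ) * g ξ ^ 2) ∂μ := by
        apply lintegral_mono_ae
        filter_upwards [Measure.ae_ne volume (0:ℝ)] with k hk
        exact hpt k hk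
    _ = ∫⁻ k : ℝ, ∫⁻ ξ, ENNReal.ofReal (G * |k| ^ (-(1/2) : ℝ)) *
         ENNReal.ofReal (Real.exp (-(|k| * |x - ξ| / 2)) * |x - ξ| ^ (1/2 : ℝ) * g ξ ^ 2) ∂μ := by
        congr 1; ext k
        rw [lintegral_const_mul]
        fun_prop
    _ = ∫⁻ ξ, ∫⁻ k : ℝ, ENNReal.ofReal (G * |k| ^ (-(1/2) : ℝ)) *
         ENNReal.ofReal (Real.exp (-(|k| * |x - ξ| / 2)) * |x - ξ| ^ (1/2 : ℝ) * g ξ ^ 2) ∂volume ∂μ := by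
        apply lintegral_lintegral_swap
        apply Measurable.aemeasurable
        simp only [Function.uncurry_def]
        fun_prop
    _ = ∫⁻ ξ, ENNReal.ofReal (G ^ 2 * g ξ ^ 2) ∂μ := by
        apply lintegral_congr_ae
        have hne : ∀ᵐ ξ ∂μ, ξ ≠ x := by
          apply ae_restrict_of_ae
          exact Measure.ae_ne volume x
        filter_upwards [hne] with ξ hξ
        have hp : 0 < |x - ξ| := abs_pos.mpr (sub_ne_zero.mpr (Ne.symm hξ))
        calc _ = ∫⁻ k : ℝ, ENNReal.ofReal (G * |x - ξ| ^ (1/2 : ℝ) * g ξ ^ 2) *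
            ENNReal.ofReal (|k| ^ (-(1/2) : ℝ) * Real.exp (-(|x - ξ| * |k| / 2))) := by
              apply lintegral_congr
              intro k
              rw [← ENNReal.ofReal_mul (by positivity), ← ENNReal.ofReal_mul (by positivity)]
              congr 1
              rw [mul_comm |k| |x - ξ|]
              ring
          _ = ENNReal.ofReal (G * |x - ξ| ^ (1/2 : ℝ) * g ξ ^ 2) * ENNReal.ofReal (G * |x - ξ| ^ (-(1/2) : ℝ)) := by
              rw [lintegral_const_mul _ (by fun_prop), hJ _ hp]
          _ = _ := by
              rw [← ENNReal.ofReal_mul (by positivity)]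
              congr 1
              have e2 : |x - ξ| ^ (1/2 : ℝ) * |x - ξ| ^ (-(1/2) : ℝ) = 1 := by
                rw [← Real.rpow_add hp]; norm_num
              linear_combination (G^2 * g ξ^2) * e2
    _ = _ := by
        rw [← ofReal_integral_eq_lintegral_ofReal]
        · rw [← intervalIntegral.integral_of_le hL.le, intervalIntegral.integral_const_mul]
        · have : Continuous (fun ξ => G ^ 2 * g ξ ^ 2) := by fun_prop
          exact this.integrableOn_Icc.mono_set Ioc_subset_Icc_self
        · filter_upwards with ξ; positivity

/-- Minkowski integral inequality (special case). -/
lemma kdv_minkowski (T : ℝ) (hT : 0 < T) (H : ℝ → ℝ → ℝ)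
    (hH : Continuous (Function.uncurry H)) (hH0 : ∀ k t, 0 ≤ H k t)
    (φ : ℝ → ℝ) (hφ : Continuous φ) (hφ0 : ∀ t, 0 ≤ φ t)
    (hb : ∀ t, ∫⁻ k, ENNReal.ofReal (H k t ^ 2) ≤ ENNReal.ofReal (φ t ^ 2)) :
    ∫⁻ k, ENNReal.ofReal ((∫ t in (0:ℝ)..T, H k t) ^ 2)
      ≤ ENNReal.ofReal ((∫ t in (0:ℝ)..T, φ t) ^ 2) := by
  set μ := volume.restrict (Ioc (0:ℝ) T) with hμ
  have hHk : ∀ k, Continuous (H k) := fun k => hH.comp (by fun_prop : Continuous fun t => (k, t))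
  have hHm := hH.measurable
  have conv : ∀ ψ : ℝ → ℝ, Continuous ψ → (∀ t, 0 ≤ ψ t) →
      ENNReal.ofReal ((∫ t in (0:ℝ)..T, ψ t) ^ 2) = (∫⁻ t, ENNReal.ofReal (ψ t) ∂μ) ^ 2 := by
    intro ψ hψ hψ0
    rw [intervalIntegral.integral_of_le hT.le, ENNReal.ofReal_pow (integral_nonneg hψ0),
      ofReal_integral_eq_lintegral_ofReal]
    · exact hψ.integrableOn_Icc.mono_set Ioc_subset_Icc_self
    · filter_upwards with t using hψ0 t
  rw [conv φ hφ hφ0]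
  simp_rw [fun k => conv (H k) (hHk k) (hH0 k)]
  have hsec : ∀ t, Measurable fun k => ENNReal.ofReal (H k t) := fun t =>
    (hHm.comp (measurable_id.prodMk measurable_const)).ennreal_ofReal
  have hsec2 : ∀ k, Measurable fun t => ENNReal.ofReal (H k t) := fun k =>
    (hHk k).measurable.ennreal_ofReal
  have h3 : Measurable (fun p : ℝ × ℝ × ℝ => ENNReal.ofReal (H p.1 p.2.1) * ENNReal.ofReal (H p.1 p.2.2)) := by
    refine Measurable.mul (f := fun p : ℝ × ℝ × ℝ => ENNReal.ofReal (H p.1 p.2.1))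
      (g := fun p : ℝ × ℝ × ℝ => ENNReal.ofReal (H p.1 p.2.2)) ?_ ?_
    · exact (hHm.comp (measurable_fst.prodMk (measurable_fst.comp measurable_snd))).ennreal_ofReal
    · exact (hHm.comp (measurable_fst.prodMk (measurable_snd.comp measurable_snd))).ennreal_ofReal
  calc ∫⁻ k, (∫⁻ t, ENNReal.ofReal (H k t) ∂μ) ^ 2
      = ∫⁻ k, ∫⁻ t, ∫⁻ s, ENNReal.ofReal (H k t) * ENNReal.ofReal (H k s) ∂μ ∂μ := by
        congr 1; ext k
        simp_rw [lintegral_const_mul _ (hsec2 k)]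
        rw [lintegral_mul_const _ (hsec2 k), sq]
    _ = ∫⁻ t, ∫⁻ k, ∫⁻ s, ENNReal.ofReal (H k t) * ENNReal.ofReal (H k s) ∂μ ∂volume ∂μ := by
        apply lintegral_lintegral_swap
        apply Measurable.aemeasurable
        simp only [Function.uncurry_def]
        apply Measurable.lintegral_prod_right'
          (f := fun q : (ℝ × ℝ) × ℝ => ENNReal.ofReal (H q.1.1 q.1.2) * ENNReal.ofReal (H q.1.1 q.2))
        exact h3.comp (by fun_prop : Measurable fun q : (ℝ × ℝ) × ℝ => (q.1.1, q.1.2, q.2))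
    _ = ∫⁻ t, ∫⁻ s, ∫⁻ k, ENNReal.ofReal (H k t) * ENNReal.ofReal (H k s) ∂volume ∂μ ∂μ := by
        congr 1; ext t
        apply lintegral_lintegral_swap
        apply Measurable.aemeasurable
        simp only [Function.uncurry_def]
        exact h3.comp (by fun_prop : Measurable fun q : ℝ × ℝ => (q.1, t, q.2))
    _ ≤ ∫⁻ t, ∫⁻ s, ENNReal.ofReal (φ t) * ENNReal.ofReal (φ s) ∂μ ∂μ := by
        apply lintegral_mono; intro t
        apply lintegral_mono; intro s
        have h := kdv_cs volume _ _ (hsec t).aemeasurable (hsec s).aemeasurable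
        simp_rw [← fun k t => ENNReal.ofReal_pow (hH0 k t)] at h
        have h2 := h.trans (mul_le_mul' (hb t) (hb s))
        rw [ENNReal.ofReal_pow (hφ0 t), ENNReal.ofReal_pow (hφ0 s), ← mul_pow] at h2
        exact (ENNReal.pow_le_pow_left_iff (by norm_num)).mp h2
    _ = _ := by
        have hφm : Measurable fun t => ENNReal.ofReal (φ t) := hφ.measurable.ennreal_ofReal
        simp_rw [lintegral_const_mul _ hφm]
        rw [lintegral_mul_const _ hφm, sq]


lemma kdv_c2 {E X : Type*} [TopologicalSpace E] [TopologicalSpace X] {g : ℝ → ℝ → E}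
    (hg : Continuous (Function.uncurry g)) {a b : X → ℝ}
    (ha : Continuous a) (hb : Continuous b) : Continuous fun p => g (a p) (b p) :=
  hg.comp (ha.prodMk hb)

lemma kdv_swap {E : Type*} [NormedAddCommGroup E] [NormedSpace ℝ E]
    (F : ℝ → ℝ → E) (hF : Continuous (Function.uncurry F)) (a b c d : ℝ) :
    ∫ x in a..b, ∫ t in c..d, F x t = ∫ t in c..d, ∫ x in a..b, F x t := by
  apply intervalIntegral_intervalIntegral_swap
  apply (hF.continuousOn.integrableOn_compact
    (isCompact_uIcc.prod isCompact_uIcc) (K := uIcc a b ×ˢ uIcc c d)).mono_set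
  exact prod_mono uIoc_subset_uIcc uIoc_subset_uIcc

lemma kdv_cs_real (u v : ℝ → ℝ) (hu : Continuous u) (hv : Continuous v) (a b : ℝ) (hab : a ≤ b) :
    |∫ x in a..b, u x * v x| ≤ √(∫ x in a..b, u x ^ 2) * √(∫ x in a..b, v x ^ 2) := by
  have h : ∀ s : ℝ, 0 ≤ (∫ x in a..b, u x ^ 2) * (s * s) + (2 * ∫ x in a..b, u x * v x) * s
      + ∫ x in a..b, v x ^ 2 := by
    intro s
    have h0 : 0 ≤ ∫ x in a..b, (u x * s + v x) ^ 2 :=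
      intervalIntegral.integral_nonneg hab (fun x _ => by positivity)
    have e : ∫ x in a..b, (u x * s + v x) ^ 2 = (∫ x in a..b, u x ^ 2) * (s * s)
        + (2 * ∫ x in a..b, u x * v x) * s + ∫ x in a..b, v x ^ 2 := by
      rw [← intervalIntegral.integral_const_mul, ← intervalIntegral.integral_mul_const,
        ← intervalIntegral.integral_mul_const, ← intervalIntegral.integral_add,
        ← intervalIntegral.integral_add]
      · congr 1; ext x; ring
      all_goals apply Continuous.intervalIntegrable; fun_prop
    rwa [e] at h0
  have hd := discrim_le_zero h
  rw [discrim] at hd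
  rw [← Real.sqrt_mul (intervalIntegral.integral_nonneg hab (fun x _ => by positivity))]
  apply Real.abs_le_sqrt
  nlinarith

structure KdvSol (L T : ℝ) (f y yt yx yxx yxxx : ℝ → ℝ → ℝ) : Prop where
  cf : Continuous (Function.uncurry f)
  cy : Continuous (Function.uncurry y)
  cyt : Continuous (Function.uncurry yt)
  cyx : Continuous (Function.uncurry yx)
  cyxx : Continuous (Function.uncurry yxx)
  cyxxx : Continuous (Function.uncurry yxxx)
  dt : ∀ x, ∀ t ∈ Ioo 0 T, HasDerivAt (fun s => y x s) (yt x t) t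
  dx : ∀ x ∈ Ioo 0 L, ∀ t, HasDerivAt (fun s => y s t) (yx x t) x
  dxx : ∀ x ∈ Ioo 0 L, ∀ t, HasDerivAt (fun s => yx s t) (yxx x t) x
  dxxx : ∀ x ∈ Ioo 0 L, ∀ t, HasDerivAt (fun s => yxx s t) (yxxx x t) x
  pde : ∀ x t, yt x t + yx x t + yxxx x t = f x t
  b0 : ∀ t, y 0 t = 0
  b1 : ∀ t, yx L t = 0
  b2 : ∀ t, yxx L t = 0

/-- The size of the data. -/
noncomputable def kdvM (L T : ℝ) (f y : ℝ → ℝ → ℝ) : ℝ :=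
  √(∫ x in (0:ℝ)..L, y x 0 ^ 2) + ∫ t in (0:ℝ)..T, √(∫ x in (0:ℝ)..L, f x t ^ 2)

lemma kdv_cont_norm (L : ℝ) (f : ℝ → ℝ → ℝ) (hf : Continuous (Function.uncurry f)) :
    Continuous fun t => √(∫ x in (0:ℝ)..L, f x t ^ 2) := by
  apply Continuous.sqrt
  apply intervalIntegral.continuous_parametric_intervalIntegral_of_continuous'
  exact (kdv_c2 hf continuous_snd continuous_fst).pow 2

lemma kdv_energy_id {L T : ℝ} (hL : 0 < L) (hT : 0 < T) {f y yt yx yxx yxxx : ℝ → ℝ → ℝ}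
    (S : KdvSol L T f y yt yx yxx yxxx) (t : ℝ) (ht : t ∈ Icc 0 T) :
    (∫ x in (0:ℝ)..L, y x t ^ 2) + (∫ s in (0:ℝ)..t, y L s ^ 2) + (∫ s in (0:ℝ)..t, yx 0 s ^ 2)
      = (∫ x in (0:ℝ)..L, y x 0 ^ 2) + 2 * ∫ s in (0:ℝ)..t, ∫ x in (0:ℝ)..L, y x s * f x s := by
  have cy := fun t => kdv_c2 S.cy (continuous_id) (continuous_const (y := t))
  have cyx := fun t => kdv_c2 S.cyx (continuous_id) (continuous_const (y := t))
  have cyxx := fun t => kdv_c2 S.cyxx (continuous_id) (continuous_const (y := t))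
  have cyxxx := fun t => kdv_c2 S.cyxxx (continuous_id) (continuous_const (y := t))
  have cyt := fun t => kdv_c2 S.cyt (continuous_id) (continuous_const (y := t))
  have cf := fun t => kdv_c2 S.cf (continuous_id) (continuous_const (y := t))
  have cy' := fun x => kdv_c2 S.cy (continuous_const (y := x)) (continuous_id)
  have cyt' := fun x => kdv_c2 S.cyt (continuous_const (y := x)) (continuous_id)
  have cyx' := fun x => kdv_c2 S.cyx (continuous_const (y := x)) (continuous_id)
  simp only [id] at *
  have h1 : ∀ x, ∫ s in (0:ℝ)..t, 2 * (y x s * yt x s) = y x t ^ 2 - y x 0 ^ 2 := by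
    intro x
    apply intervalIntegral.integral_eq_sub_of_hasDerivAt_of_le (f := fun s => y x s ^ 2) ht.1
    · exact ((cy' x).pow 2).continuousOn
    · intro s hs
      have := (S.dt x s ⟨hs.1, hs.2.trans_le ht.2⟩).fun_pow 2
      refine this.congr_deriv ?_
      push_cast; ring
    · exact (continuous_const.mul ((cy' x).mul (cyt' x))).intervalIntegrable _ _
  have h2 : ∀ s, ∫ x in (0:ℝ)..L, 2 * (y x s * yt x s)
      = 2 * (∫ x in (0:ℝ)..L, y x s * f x s) - y L s ^ 2 - yx 0 s ^ 2 := by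
    intro s
    have e : ∫ x in (0:ℝ)..L, 2 * (y x s * (yx x s + yxxx x s)) = y L s ^ 2 + yx 0 s ^ 2 := by
      have := intervalIntegral.integral_eq_sub_of_hasDerivAt_of_le
        (f := fun x => y x s ^ 2 + 2 * (y x s * yxx x s) - yx x s ^ 2)
        (f' := fun x => 2 * (y x s * (yx x s + yxxx x s))) hL.le ?_ ?_ ?_
      · rw [this, S.b0, S.b1, S.b2]; ring
      · exact ((((cy s).pow 2).add (continuous_const.mul ((cy s).mul (cyxx s)))).sub
          ((cyx s).pow 2)).continuousOn
      · intro x hx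
        have := (((S.dx x hx s).fun_pow 2).add
          (((S.dx x hx s).mul (S.dxxx x hx s)).const_mul 2)).sub ((S.dxx x hx s).fun_pow 2)
        refine HasDerivAt.congr_deriv (f := fun x => y x s ^ 2 + 2 * (y x s * yxx x s) - yx x s ^ 2)
          this ?_
        push_cast; ring
      · exact (continuous_const.mul ((cy s).mul ((cyx s).add (cyxxx s)))).intervalIntegrable _ _
    have e2 : ∫ x in (0:ℝ)..L, 2 * (y x s * yt x s)
        = ∫ x in (0:ℝ)..L, (2 * (y x s * f x s) - 2 * (y x s * (yx x s + yxxx x s))) := by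
      congr 1; ext x; rw [← S.pde]; ring
    rw [e2, intervalIntegral.integral_sub, e, intervalIntegral.integral_const_mul]
    · ring
    · exact (continuous_const.mul ((cy s).mul (cf s))).intervalIntegrable _ _
    · exact (continuous_const.mul ((cy s).mul ((cyx s).add (cyxxx s)))).intervalIntegrable _ _
  have h3 := kdv_swap (fun x s => 2 * (y x s * yt x s))
    ((continuous_const (y := (2:ℝ))).mul (S.cy.mul S.cyt)) 0 L 0 t
  simp_rw [h1, h2] at h3
  rw [intervalIntegral.integral_sub, intervalIntegral.integral_sub, intervalIntegral.integral_sub,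
    intervalIntegral.integral_const_mul] at h3
  · linarith
  · apply Continuous.intervalIntegrable
    apply continuous_const.mul
    apply intervalIntegral.continuous_parametric_intervalIntegral_of_continuous'
    exact (kdv_c2 S.cy continuous_snd continuous_fst).mul (kdv_c2 S.cf continuous_snd continuous_fst)
  · exact ((cy' L).pow 2).intervalIntegrable _ _
  · apply Continuous.intervalIntegrable
    apply Continuous.sub _ ((cy' L).pow 2)
    apply continuous_const.mul
    apply intervalIntegral.continuous_parametric_intervalIntegral_of_continuous'
    exact (kdv_c2 S.cy continuous_snd continuous_fst).mul (kdv_c2 S.cf continuous_snd continuous_fst)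
  · exact ((cyx' 0).pow 2).intervalIntegrable _ _
  · exact ((cy t).pow 2).intervalIntegrable _ _
  · exact ((cy 0).pow 2).intervalIntegrable _ _

lemma kdvM_nonneg {L T : ℝ} (hT : 0 < T) (f y : ℝ → ℝ → ℝ) : 0 ≤ kdvM L T f y := by
  unfold kdvM
  have : 0 ≤ ∫ t in (0:ℝ)..T, √(∫ x in (0:ℝ)..L, f x t ^ 2) :=
    intervalIntegral.integral_nonneg hT.le (fun t _ => Real.sqrt_nonneg _)
  positivity

lemma kdv_energy {L T : ℝ} (hL : 0 < L) (hT : 0 < T) {f y yt yx yxx yxxx : ℝ → ℝ → ℝ}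
    (S : KdvSol L T f y yt yx yxx yxxx) :
    (∀ t ∈ Icc 0 T, ∫ x in (0:ℝ)..L, y x t ^ 2 ≤ 4 * kdvM L T f y ^ 2) ∧
    ∫ s in (0:ℝ)..T, y L s ^ 2 ≤ 5 * kdvM L T f y ^ 2 ∧
    ∫ s in (0:ℝ)..T, yx 0 s ^ 2 ≤ 5 * kdvM L T f y ^ 2 := by
  have cy := fun t => kdv_c2 S.cy (continuous_id) (continuous_const (y := t))
  have cf := fun t => kdv_c2 S.cf (continuous_id) (continuous_const (y := t))
  have cN := kdv_cont_norm L y S.cy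
  have cP := kdv_cont_norm L f S.cf
  obtain ⟨tm, htm, hmax⟩ := isCompact_Icc.exists_isMaxOn (nonempty_Icc.mpr hT.le) cN.continuousOn
  set m := √(∫ x in (0:ℝ)..L, y x tm ^ 2) with hm
  set Φ := ∫ t in (0:ℝ)..T, √(∫ x in (0:ℝ)..L, f x t ^ 2) with hΦ
  set e0 := √(∫ x in (0:ℝ)..L, y x 0 ^ 2) with he0
  have hM : kdvM L T f y = e0 + Φ := rfl
  have hΦ0 : 0 ≤ Φ := intervalIntegral.integral_nonneg hT.le (fun t _ => Real.sqrt_nonneg _)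
  have he00 : 0 ≤ e0 := Real.sqrt_nonneg _
  have hm0 : 0 ≤ m := Real.sqrt_nonneg _
  have sq0 : ∀ t, 0 ≤ ∫ x in (0:ℝ)..L, y x t ^ 2 := fun t =>
    intervalIntegral.integral_nonneg hL.le (fun t _ => by positivity)
  have rhs : ∀ t ∈ Icc 0 T, ∫ s in (0:ℝ)..t, ∫ x in (0:ℝ)..L, y x s * f x s ≤ m * Φ := by
    intro t ht
    calc ∫ s in (0:ℝ)..t, ∫ x in (0:ℝ)..L, y x s * f x s
        ≤ ∫ s in (0:ℝ)..t, m * √(∫ x in (0:ℝ)..L, f x s ^ 2) := by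
          apply intervalIntegral.integral_mono_on ht.1
          · apply Continuous.intervalIntegrable
            apply intervalIntegral.continuous_parametric_intervalIntegral_of_continuous'
            exact (kdv_c2 S.cy continuous_snd continuous_fst).mul
              (kdv_c2 S.cf continuous_snd continuous_fst)
          · exact (continuous_const.mul cP).intervalIntegrable _ _
          · intro s hs
            refine (le_abs_self _).trans ((kdv_cs_real _ _ (cy s) (cf s) 0 L hL.le).trans ?_)
            apply mul_le_mul_of_nonneg_right _ (Real.sqrt_nonneg _)
            exact hmax ⟨hs.1, hs.2.trans ht.2⟩
      _ ≤ ∫ s in (0:ℝ)..T, m * √(∫ x in (0:ℝ)..L, f x s ^ 2) := by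
          apply intervalIntegral.integral_mono_interval le_rfl ht.1 ht.2
          · filter_upwards with s using mul_nonneg hm0 (Real.sqrt_nonneg _)
          · exact (continuous_const.mul cP).intervalIntegrable _ _
      _ = m * Φ := by rw [intervalIntegral.integral_const_mul]
  have nn : ∀ (u : ℝ → ℝ) (t : ℝ), t ∈ Icc 0 T → 0 ≤ ∫ s in (0:ℝ)..t, u s ^ 2 := fun u t ht =>
    intervalIntegral.integral_nonneg ht.1 (fun t _ => by positivity)
  have hb : m ^ 2 ≤ e0 ^ 2 + 2 * (m * Φ) := by
    rw [hm, Real.sq_sqrt (sq0 _), he0, Real.sq_sqrt (sq0 _)]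
    have := kdv_energy_id hL hT S tm htm
    have := rhs tm htm
    have := nn (fun s => y L s) tm htm
    have := nn (fun s => yx 0 s) tm htm
    linarith
  have hm2 : m ≤ e0 + 2 * Φ := by
    by_contra hc
    push Not at hc
    nlinarith
  refine ⟨fun t ht => ?_, ?_⟩
  · have h1 : √(∫ x in (0:ℝ)..L, y x t ^ 2) ≤ m := hmax ht
    rw [← Real.sq_sqrt (sq0 t), hM]
    have h0 := Real.sqrt_nonneg (∫ x in (0:ℝ)..L, y x t ^ 2)
    nlinarith
  · have hTm : T ∈ Icc 0 T := ⟨hT.le, le_rfl⟩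
    have := kdv_energy_id hL hT S T hTm
    have := rhs T hTm
    have h1 := nn (fun s => y L s) T hTm
    have h2 := nn (fun s => yx 0 s) T hTm
    have h3 := sq0 T
    have h4 : ∫ x in (0:ℝ)..L, y x 0 ^ 2 = e0 ^ 2 := by rw [he0, Real.sq_sqrt (sq0 _)]
    have h5 : m * Φ ≤ 2 * (e0 + Φ) * (e0 + Φ) := by
      apply mul_le_mul <;> linarith
    rw [hM]
    constructor <;> nlinarith


noncomputable def kdvE (w t : ℝ) : ℂ := Complex.exp (-(Complex.I * w * t))

noncomputable def kdvHat (T w : ℝ) (g : ℝ → ℝ) : ℂ := ∫ t in (0:ℝ)..T, kdvE w t * (g t : ℂ)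

lemma kdvE_norm (w t : ℝ) : ‖kdvE w t‖ = 1 := by
  unfold kdvE; simp [Complex.norm_exp]

lemma kdvE_cont : Continuous (Function.uncurry kdvE) := by
  unfold kdvE; simp only [Function.uncurry_def]; fun_prop

lemma kdvE_cont' (w : ℝ) : Continuous (kdvE w) := by
  unfold kdvE; fun_prop

lemma kdv_cc {X : Type*} [TopologicalSpace X] {g : ℝ → ℝ → ℝ}
    (hg : Continuous (Function.uncurry g)) {a b : X → ℝ}
    (ha : Continuous a) (hb : Continuous b) : Continuous fun p => ((g (a p) (b p) : ℝ) : ℂ) :=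
  Complex.continuous_ofReal.comp (kdv_c2 hg ha hb)

lemma kdv_inner_cont {g : ℝ → ℝ → ℝ} (hg : Continuous (Function.uncurry g)) (φ : ℝ → ℂ)
    (hφ : Continuous φ) (c b : ℝ) : Continuous fun t => ∫ ξ in c..b, φ ξ * (g ξ t : ℂ) := by
  apply intervalIntegral.continuous_parametric_intervalIntegral_of_continuous'
  exact (hφ.comp continuous_snd).mul (kdv_cc hg continuous_snd continuous_fst)

lemma kdv_time {L T : ℝ} (hT : 0 < T) {f y yt yx yxx yxxx : ℝ → ℝ → ℝ}
    (S : KdvSol L T f y yt yx yxx yxxx) (w : ℝ) (φ : ℝ → ℂ) (hφ : Continuous φ) (c b : ℝ) :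
    ∫ t in (0:ℝ)..T, kdvE w t * ∫ ξ in c..b, φ ξ * (yt ξ t : ℂ)
      = (∫ ξ in c..b, φ ξ * (kdvE w T * y ξ T - y ξ 0))
        + Complex.I * w * ∫ t in (0:ℝ)..T, kdvE w t * ∫ ξ in c..b, φ ξ * (y ξ t : ℂ) := by
  have sw : ∀ g : ℝ → ℝ → ℝ, Continuous (Function.uncurry g) →
      ∫ t in (0:ℝ)..T, kdvE w t * ∫ ξ in c..b, φ ξ * (g ξ t : ℂ)
      = ∫ ξ in c..b, φ ξ * ∫ t in (0:ℝ)..T, kdvE w t * (g ξ t : ℂ) := by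
    intro g hg
    simp_rw [← intervalIntegral.integral_const_mul]
    rw [kdv_swap]
    · congr 1; ext ξ; congr 1; ext t; ring
    · exact (kdv_c2 kdvE_cont continuous_const continuous_fst).mul
        ((hφ.comp continuous_snd).mul (kdv_cc hg continuous_snd continuous_fst))
  rw [sw _ S.cyt, sw _ S.cy, ← intervalIntegral.integral_const_mul, ← intervalIntegral.integral_add]
  · congr 1; ext ξ
    have h := intervalIntegral.integral_eq_sub_of_hasDerivAt_of_le
      (f := fun t => kdvE w t * (y ξ t : ℂ))
      (f' := fun t => kdvE w t * (yt ξ t : ℂ) - Complex.I * w * (kdvE w t * (y ξ t : ℂ))) hT.le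
      ?_ ?_ ?_
    · rw [intervalIntegral.integral_sub, intervalIntegral.integral_const_mul] at h
      · have e0 : kdvE w 0 = 1 := by simp [kdvE]
        rw [e0] at h
        linear_combination φ ξ * h
      · exact ((kdvE_cont' w).mul (kdv_cc S.cyt continuous_const continuous_id)).intervalIntegrable _ _
      · exact (continuous_const.mul ((kdvE_cont' w).mul
          (kdv_cc S.cy continuous_const continuous_id))).intervalIntegrable _ _
    · exact ((kdvE_cont' w).mul (kdv_cc S.cy continuous_const continuous_id)).continuousOn
    · intro t ht
      have h1 : HasDerivAt (fun t : ℝ => kdvE w t) (kdvE w t * (-(Complex.I * w))) t := by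
        unfold kdvE
        have h2 : HasDerivAt (fun t : ℝ => -(Complex.I * w * (t:ℂ))) (-(Complex.I * w * 1)) t :=
          ((Complex.ofRealCLM.hasDerivAt (x := t)).const_mul (Complex.I * w)).neg
        rw [mul_one] at h2
        exact h2.cexp
      refine HasDerivAt.congr_deriv (f := fun t => kdvE w t * (y ξ t : ℂ))
        (h1.mul (S.dt ξ t ht).ofReal_comp) ?_
      ring
    · apply Continuous.intervalIntegrable
      exact ((kdvE_cont' w).mul (kdv_cc S.cyt continuous_const continuous_id)).sub
        (continuous_const.mul ((kdvE_cont' w).mul (kdv_cc S.cy continuous_const continuous_id)))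
  · apply Continuous.intervalIntegrable
    exact hφ.mul ((continuous_const.mul (kdv_cc S.cy continuous_id continuous_const)).sub
      (kdv_cc S.cy continuous_id continuous_const))
  · apply Continuous.intervalIntegrable
    apply continuous_const.mul
    apply hφ.mul
    apply intervalIntegral.continuous_parametric_intervalIntegral_of_continuous'
    exact (kdv_c2 kdvE_cont continuous_const continuous_snd).mul
      (kdv_cc S.cy continuous_fst continuous_snd)

/-- Integrating a space identity against the time exponential. -/
lemma kdv_integrate {L T : ℝ} (hT : 0 < T) {f y yt yx yxx yxxx : ℝ → ℝ → ℝ}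
    (S : KdvSol L T f y yt yx yxx yxxx) (w : ℝ) (φ ψ : ℝ → ℂ) (hφ : Continuous φ)
    (hψ : Continuous ψ) (c b : ℝ) (A : ℝ → ℂ)
    (hA : ∀ t, A t = (∫ ξ in c..b, φ ξ * (f ξ t : ℂ)) - (∫ ξ in c..b, φ ξ * (yt ξ t : ℂ))
      + ∫ ξ in c..b, ψ ξ * (y ξ t : ℂ)) :
    ∫ t in (0:ℝ)..T, kdvE w t * A t
      = (∫ t in (0:ℝ)..T, kdvE w t * ∫ ξ in c..b, φ ξ * (f ξ t : ℂ))
        - (∫ ξ in c..b, φ ξ * (kdvE w T * y ξ T - y ξ 0))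
        - Complex.I * w * (∫ t in (0:ℝ)..T, kdvE w t * ∫ ξ in c..b, φ ξ * (y ξ t : ℂ))
        + ∫ t in (0:ℝ)..T, kdvE w t * ∫ ξ in c..b, ψ ξ * (y ξ t : ℂ) := by
  have e : ∀ t, kdvE w t * A t = kdvE w t * (∫ ξ in c..b, φ ξ * (f ξ t : ℂ))
      - kdvE w t * (∫ ξ in c..b, φ ξ * (yt ξ t : ℂ))
      + kdvE w t * ∫ ξ in c..b, ψ ξ * (y ξ t : ℂ) := by
    intro t; rw [hA t]; ring
  simp_rw [e]
  have i1 : IntervalIntegrable (fun t => kdvE w t * ∫ ξ in c..b, φ ξ * (f ξ t : ℂ)) volume 0 T := ((kdvE_cont' w).mul (kdv_inner_cont S.cf φ hφ c b)).intervalIntegrable (μ := volume) 0 T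
  have i2 : IntervalIntegrable (fun t => kdvE w t * ∫ ξ in c..b, φ ξ * (yt ξ t : ℂ)) volume 0 T := ((kdvE_cont' w).mul (kdv_inner_cont S.cyt φ hφ c b)).intervalIntegrable (μ := volume) 0 T
  have i3 : IntervalIntegrable (fun t => kdvE w t * ∫ ξ in c..b, ψ ξ * (y ξ t : ℂ)) volume 0 T := ((kdvE_cont' w).mul (kdv_inner_cont S.cy ψ hψ c b)).intervalIntegrable (μ := volume) 0 T
  have i12 : IntervalIntegrable (fun t => kdvE w t * (∫ ξ in c..b, φ ξ * (f ξ t : ℂ))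
      - kdvE w t * ∫ ξ in c..b, φ ξ * (yt ξ t : ℂ)) volume 0 T := i1.sub i2
  rw [intervalIntegral.integral_add i12 i3, intervalIntegral.integral_sub i1 i2,
    kdv_time hT S w φ hφ c b]
  ring

/-- first-order equation for each mode, integrated. -/
lemma kdv_mode {L T : ℝ} (hT : 0 < T) {f y yt yx yxx yxxx : ℝ → ℝ → ℝ}
    (S : KdvSol L T f y yt yx yxx yxxx) (w : ℝ) (l : ℂ) (hl : l * (l ^ 2 + 1) = -(Complex.I * w))
    (x0 c b : ℝ) (hc : 0 ≤ c) (hcb : c ≤ b) (hb : b ≤ L) :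
    Complex.exp (l * (x0 - b)) * (kdvHat T w (yxx b) + l * kdvHat T w (yx b)
        + (l ^ 2 + 1) * kdvHat T w (y b))
      - Complex.exp (l * (x0 - c)) * (kdvHat T w (yxx c) + l * kdvHat T w (yx c)
        + (l ^ 2 + 1) * kdvHat T w (y c))
      = (∫ t in (0:ℝ)..T, kdvE w t * ∫ ξ in c..b, Complex.exp (l * (x0 - ξ)) * (f ξ t : ℂ))
        - kdvE w T * (∫ ξ in c..b, Complex.exp (l * (x0 - ξ)) * (y ξ T : ℂ))
        + ∫ ξ in c..b, Complex.exp (l * (x0 - ξ)) * (y ξ 0 : ℂ) := by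
  set φ : ℝ → ℂ := fun ξ => Complex.exp (l * (x0 - ξ)) with hφd
  have hφ : Continuous φ := by fun_prop
  set P : ℝ → ℝ → ℂ := fun x t => φ x * (yxx x t + l * yx x t + (l ^ 2 + 1) * y x t) with hP
  have hint : ∀ x, ∫ t in (0:ℝ)..T, kdvE w t * P x t = φ x * (kdvHat T w (yxx x)
      + l * kdvHat T w (yx x) + (l ^ 2 + 1) * kdvHat T w (y x)) := by
    intro x
    unfold kdvHat
    rw [← intervalIntegral.integral_const_mul, ← intervalIntegral.integral_const_mul,
      ← intervalIntegral.integral_add, ← intervalIntegral.integral_add,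
      ← intervalIntegral.integral_const_mul]
    · congr 1; ext t; simp only [hP]; ring
    all_goals
      apply Continuous.intervalIntegrable
    · exact ((kdvE_cont' w).mul (kdv_cc S.cyxx continuous_const continuous_id)).add
        (continuous_const.mul ((kdvE_cont' w).mul (kdv_cc S.cyx continuous_const continuous_id)))
    · exact continuous_const.mul ((kdvE_cont' w).mul (kdv_cc S.cy continuous_const continuous_id))
    · exact ((kdvE_cont' w).mul (kdv_cc S.cyxx continuous_const continuous_id))
    · exact continuous_const.mul ((kdvE_cont' w).mul (kdv_cc S.cyx continuous_const continuous_id))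
  have hA : ∀ t, P b t - P c t = (∫ ξ in c..b, φ ξ * (f ξ t : ℂ))
      - (∫ ξ in c..b, φ ξ * (yt ξ t : ℂ))
      + ∫ ξ in c..b, (Complex.I * w * φ ξ) * (y ξ t : ℂ) := by
    intro t
    have cyt := kdv_cc S.cyt continuous_id (continuous_const (y := t))
    have cy := kdv_cc S.cy continuous_id (continuous_const (y := t))
    have cf := kdv_cc S.cf continuous_id (continuous_const (y := t))
    have cyx := kdv_cc S.cyx continuous_id (continuous_const (y := t))
    have cyxx := kdv_cc S.cyxx continuous_id (continuous_const (y := t))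
    rw [← intervalIntegral.integral_sub, ← intervalIntegral.integral_add]
    · symm
      apply intervalIntegral.integral_eq_sub_of_hasDerivAt_of_le (f := fun x => P x t) hcb
      · apply Continuous.continuousOn
        exact hφ.mul ((cyxx.add (continuous_const.mul cyx)).add (continuous_const.mul cy))
      · intro x hx
        have hx' : x ∈ Ioo 0 L := ⟨hc.trans_lt hx.1, hx.2.trans_le hb⟩
        have h1 : HasDerivAt φ (φ x * (-l)) x := by
          have h2 : HasDerivAt (fun x : ℝ => l * ((x0:ℂ) - (x:ℂ))) (l * (0 - 1)) x :=
            ((hasDerivAt_const x (x0:ℂ)).sub (Complex.ofRealCLM.hasDerivAt (x := x))).const_mul l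
          have := h2.cexp
          convert this using 1
          ring
        have h3 := h1.mul (((S.dxxx x hx' t).ofReal_comp.add
          ((S.dxx x hx' t).ofReal_comp.const_mul l)).add
          ((S.dx x hx' t).ofReal_comp.const_mul (l ^ 2 + 1)))
        refine HasDerivAt.congr_deriv (f := fun x => P x t) h3 ?_
        rw [← S.pde x t]
        simp only [Pi.add_apply]
        push_cast
        linear_combination (-(φ x) * (y x t)) * hl
      · apply Continuous.intervalIntegrable
        exact ((hφ.mul cf).sub (hφ.mul cyt)).add ((continuous_const.mul hφ).mul cy)
    · exact ((hφ.mul cf).sub (hφ.mul cyt)).intervalIntegrable _ _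
    · exact ((continuous_const.mul hφ).mul cy).intervalIntegrable _ _
    · exact (hφ.mul cf).intervalIntegrable _ _
    · exact (hφ.mul cyt).intervalIntegrable _ _
  have h := kdv_integrate hT S w φ (fun ξ => Complex.I * w * φ ξ) hφ (continuous_const.mul hφ) c b
    (fun t => P b t - P c t) hA
  have cP : ∀ x, Continuous fun t => kdvE w t * P x t := by
    intro x
    exact (kdvE_cont' w).mul (continuous_const.mul
      (((kdv_cc S.cyxx continuous_const continuous_id).add
      (continuous_const.mul (kdv_cc S.cyx continuous_const continuous_id))).add
      (continuous_const.mul (kdv_cc S.cy continuous_const continuous_id))))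
  simp_rw [mul_sub] at h
  rw [intervalIntegral.integral_sub ((cP b).intervalIntegrable _ _)
    ((cP c).intervalIntegrable _ _), hint, hint] at h
  rw [h]
  have e1 : ∫ t in (0:ℝ)..T, kdvE w t * ∫ ξ in c..b, (Complex.I * w * φ ξ) * (y ξ t : ℂ)
      = Complex.I * w * ∫ t in (0:ℝ)..T, kdvE w t * ∫ ξ in c..b, φ ξ * (y ξ t : ℂ) := by
    rw [← intervalIntegral.integral_const_mul]
    congr 1; ext t
    simp_rw [mul_assoc]
    rw [intervalIntegral.integral_const_mul, intervalIntegral.integral_const_mul]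
    ring
  have e2 : ∫ ξ in c..b, (φ ξ * (kdvE w T * (y ξ T : ℂ)) - φ ξ * (y ξ 0 : ℂ))
      = kdvE w T * (∫ ξ in c..b, φ ξ * (y ξ T : ℂ)) - ∫ ξ in c..b, φ ξ * (y ξ 0 : ℂ) := by
    rw [intervalIntegral.integral_sub, ← intervalIntegral.integral_const_mul]
    · congr 2; ext ξ; ring
    · exact (hφ.mul (continuous_const.mul
        (kdv_cc S.cy continuous_id continuous_const))).intervalIntegrable _ _
    · exact (hφ.mul (kdv_cc S.cy continuous_id continuous_const)).intervalIntegrable _ _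
  rw [e1, e2]
  ring

lemma kdv_mode_bound {L T : ℝ} (hT : 0 < T) {f y yt yx yxx yxxx : ℝ → ℝ → ℝ}
    (S : KdvSol L T f y yt yx yxx yxxx) (w : ℝ) (l : ℂ) (hl : l * (l ^ 2 + 1) = -(Complex.I * w))
    (x0 c b : ℝ) (hc : 0 ≤ c) (hcb : c ≤ b) (hb : b ≤ L) (Q : (ℝ → ℝ) → ℝ)
    (hQf : Continuous fun t => Q (fun ξ => f ξ t))
    (hQ : ∀ g : ℝ → ℝ, Continuous g → ‖∫ ξ in c..b, Complex.exp (l * (x0 - ξ)) * (g ξ : ℂ)‖ ≤ Q g) :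
    ‖Complex.exp (l * (x0 - b)) * (kdvHat T w (yxx b) + l * kdvHat T w (yx b)
        + (l ^ 2 + 1) * kdvHat T w (y b))
      - Complex.exp (l * (x0 - c)) * (kdvHat T w (yxx c) + l * kdvHat T w (yx c)
        + (l ^ 2 + 1) * kdvHat T w (y c))‖
      ≤ (∫ t in (0:ℝ)..T, Q (fun ξ => f ξ t)) + Q (fun ξ => y ξ T) + Q (fun ξ => y ξ 0) := by
  rw [kdv_mode hT S w l hl x0 c b hc hcb hb]
  refine (norm_add_le _ _).trans (add_le_add ((norm_sub_le _ _).trans (add_le_add ?_ ?_)) ?_)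
  · apply intervalIntegral.norm_integral_le_of_norm_le hT.le _ (hQf.intervalIntegrable _ _)
    filter_upwards with t _
    rw [norm_mul, kdvE_norm, one_mul]
    exact hQ _ (kdv_c2 S.cf continuous_id continuous_const)
  · rw [norm_mul, kdvE_norm, one_mul]
    exact hQ _ (kdv_c2 S.cy continuous_id continuous_const)
  · exact hQ _ (kdv_c2 S.cy continuous_id continuous_const)

/-- Low frequency bound. -/
lemma kdv_low {L T : ℝ} (hL : 0 < L) (hT : 0 < T) : ∃ C : ℝ, 0 ≤ C ∧
    ∀ {f y yt yx yxx yxxx : ℝ → ℝ → ℝ} (_ : KdvSol L T f y yt yx yxx yxxx) (w : ℝ), |w| ≤ 6 →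
    ∀ x ∈ Icc 0 L, ‖kdvHat T w (yx x)‖ ≤ C * kdvM L T f y := by
  refine ⟨L * √L + (3 * (L * √L)) + 6 * (T * (L * √L * 2)) + T * (√L * 2) + L * (√T * 3),
    by positivity, ?_⟩
  intro f y yt yx yxx yxxx S w hw x hx
  obtain ⟨hE1, hE2, hE3⟩ := kdv_energy hL hT S
  set M := kdvM L T f y with hM
  have hM0 : 0 ≤ M := kdvM_nonneg hT f y
  set φ : ℝ → ℂ := fun ξ => ((ξ - x : ℝ) : ℂ) with hφd
  have hφ : Continuous φ := by fun_prop
  have hA : ∀ t, (yx x t + (L - x) * y L t : ℂ) = (∫ ξ in x..L, φ ξ * (f ξ t : ℂ))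
      - (∫ ξ in x..L, φ ξ * (yt ξ t : ℂ)) + ∫ ξ in x..L, (1:ℂ) * (y ξ t : ℂ) := by
    intro t
    have cyt := kdv_cc S.cyt continuous_id (continuous_const (y := t))
    have cy := kdv_cc S.cy continuous_id (continuous_const (y := t))
    have cf := kdv_cc S.cf continuous_id (continuous_const (y := t))
    have cyx := kdv_cc S.cyx continuous_id (continuous_const (y := t))
    have cyxx := kdv_cc S.cyxx continuous_id (continuous_const (y := t))
    rw [← intervalIntegral.integral_sub, ← intervalIntegral.integral_add]
    · have := intervalIntegral.integral_eq_sub_of_hasDerivAt_of_le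
        (f := fun ξ => φ ξ * (yxx ξ t : ℂ) - (yx ξ t : ℂ) + φ ξ * (y ξ t : ℂ))
        (f' := fun ξ => φ ξ * (f ξ t : ℂ) - φ ξ * (yt ξ t : ℂ) + 1 * (y ξ t : ℂ)) hx.2 ?_ ?_ ?_
      · rw [this]
        simp [hφd, S.b1, S.b2]
        ring
      · exact (((hφ.mul cyxx).sub cyx).add (hφ.mul cy)).continuousOn
      · intro z hz
        have hz' : z ∈ Ioo 0 L := ⟨hx.1.trans_lt hz.1, hz.2⟩
        have h1 : HasDerivAt φ ((1:ℝ):ℂ) z :=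
          ((hasDerivAt_id z).sub_const x).ofReal_comp
        have h3 := ((h1.mul (S.dxxx z hz' t).ofReal_comp).sub (S.dxx z hz' t).ofReal_comp).add
          (h1.mul (S.dx z hz' t).ofReal_comp)
        refine HasDerivAt.congr_deriv
          (f := fun ξ => φ ξ * (yxx ξ t : ℂ) - (yx ξ t : ℂ) + φ ξ * (y ξ t : ℂ)) h3 ?_
        rw [← S.pde z t]
        push_cast
        ring
      · apply Continuous.intervalIntegrable
        exact ((hφ.mul cf).sub (hφ.mul cyt)).add (continuous_const.mul cy)
    · exact ((hφ.mul cf).sub (hφ.mul cyt)).intervalIntegrable _ _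
    · exact (continuous_const.mul cy).intervalIntegrable _ _
    · exact (hφ.mul cf).intervalIntegrable _ _
    · exact (hφ.mul cyt).intervalIntegrable _ _
  have h := kdv_integrate hT S w φ (fun _ => 1) hφ continuous_const x L _ hA
  have e1 : ∫ t in (0:ℝ)..T, kdvE w t * (yx x t + (L - x) * y L t : ℂ)
      = kdvHat T w (yx x) + (L - x) * kdvHat T w (y L) := by
    unfold kdvHat
    rw [← intervalIntegral.integral_const_mul, ← intervalIntegral.integral_add]
    · congr 1; ext t; ring
    · exact ((kdvE_cont' w).mul (kdv_cc S.cyx continuous_const continuous_id)).intervalIntegrable _ _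
    · exact (continuous_const.mul ((kdvE_cont' w).mul
        (kdv_cc S.cy continuous_const continuous_id))).intervalIntegrable _ _
  rw [e1] at h
  -- bound for spatial integrals
  have hsp : ∀ (θ : ℝ → ℝ) (B : ℝ), Continuous θ → 0 ≤ B → (∀ ξ ∈ Icc x L, |θ ξ| ≤ B) →
      ∀ g : ℝ → ℝ, Continuous g →
      ‖∫ ξ in x..L, ((θ ξ : ℝ) : ℂ) * (g ξ : ℂ)‖ ≤ B * √L * √(∫ ξ in (0:ℝ)..L, g ξ ^ 2) := by
    intro θ B hθ hB hb g hg
    have e : ∫ ξ in x..L, ((θ ξ : ℝ) : ℂ) * (g ξ : ℂ) = ((∫ ξ in x..L, θ ξ * g ξ : ℝ) : ℂ) := by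
      rw [← intervalIntegral.integral_ofReal]; congr 1; ext ξ; push_cast; rfl
    rw [e, Complex.norm_real, Real.norm_eq_abs]
    refine (kdv_cs_real θ g hθ hg x L hx.2).trans ?_
    apply mul_le_mul _ _ (Real.sqrt_nonneg _) (by positivity)
    · rw [Real.sqrt_le_left (by positivity), mul_pow, Real.sq_sqrt hL.le]
      calc ∫ ξ in x..L, θ ξ ^ 2 ≤ ∫ ξ in x..L, B ^ 2 := by
            apply intervalIntegral.integral_mono_on hx.2 ((hθ.pow 2).intervalIntegrable _ _)
              (continuous_const.intervalIntegrable _ _)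
            intro ξ hξ
            have := pow_le_pow_left₀ (abs_nonneg (θ ξ)) (hb ξ hξ) 2
            rw [sq_abs] at this
            exact this
        _ = (L - x) * B ^ 2 := by simp
        _ ≤ B ^ 2 * L := by nlinarith [hx.1, sq_nonneg B]
    · apply Real.sqrt_le_sqrt
      apply intervalIntegral.integral_mono_interval hx.1 hx.2 le_rfl
      · filter_upwards with s; positivity
      · exact (hg.pow 2).intervalIntegrable _ _
  have hφb : ∀ ξ ∈ Icc x L, |ξ - x| ≤ L := by
    intro ξ hξ; rw [abs_le]; constructor <;> linarith [hξ.1, hξ.2, hx.1]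
  have spφ := hsp (fun ξ => ξ - x) L (by fun_prop) hL.le hφb
  have sp1 := hsp (fun _ => 1) 1 (by fun_prop) zero_le_one (by intro ξ _; simp)
  have cyn : ∀ t, Continuous fun ξ => y ξ t := fun t => kdv_c2 S.cy continuous_id continuous_const
  have ny : ∀ t ∈ Icc 0 T, √(∫ ξ in (0:ℝ)..L, y ξ t ^ 2) ≤ 2 * M := by
    intro t ht
    rw [Real.sqrt_le_left (by positivity)]
    nlinarith [hE1 t ht]
  have hΦ0 : 0 ≤ ∫ t in (0:ℝ)..T, √(∫ x in (0:ℝ)..L, f x t ^ 2) :=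
    intervalIntegral.integral_nonneg hT.le (fun t _ => Real.sqrt_nonneg _)
  have ny0 : √(∫ ξ in (0:ℝ)..L, y ξ 0 ^ 2) ≤ M := by
    rw [hM, kdvM]; linarith
  have nf : ∫ t in (0:ℝ)..T, √(∫ x in (0:ℝ)..L, f x t ^ 2) ≤ M := by
    rw [hM, kdvM]; linarith [Real.sqrt_nonneg (∫ x in (0:ℝ)..L, y x 0 ^ 2)]
  have t1 : ‖∫ t in (0:ℝ)..T, kdvE w t * ∫ ξ in x..L, φ ξ * (f ξ t : ℂ)‖ ≤ L * √L * M := by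
    calc _ ≤ ∫ t in (0:ℝ)..T, L * √L * √(∫ x in (0:ℝ)..L, f x t ^ 2) := by
          apply intervalIntegral.norm_integral_le_of_norm_le hT.le _
            ((continuous_const.mul (kdv_cont_norm L f S.cf)).intervalIntegrable _ _)
          filter_upwards with t _
          rw [norm_mul, kdvE_norm, one_mul]
          exact spφ _ (kdv_c2 S.cf continuous_id continuous_const)
      _ = L * √L * ∫ t in (0:ℝ)..T, √(∫ x in (0:ℝ)..L, f x t ^ 2) := by
          rw [intervalIntegral.integral_const_mul]
      _ ≤ _ := by gcongr
  have t2 : ‖∫ ξ in x..L, φ ξ * (kdvE w T * (y ξ T : ℂ) - (y ξ 0 : ℂ))‖ ≤ L * √L * (3 * M) := by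
    have e2 : ∫ ξ in x..L, φ ξ * (kdvE w T * (y ξ T : ℂ) - (y ξ 0 : ℂ))
      = kdvE w T * (∫ ξ in x..L, φ ξ * (y ξ T : ℂ)) - ∫ ξ in x..L, φ ξ * (y ξ 0 : ℂ) := by
      rw [← intervalIntegral.integral_const_mul, ← intervalIntegral.integral_sub]
      · congr 1; ext ξ; ring
      · exact (continuous_const.mul (hφ.mul
          (kdv_cc S.cy continuous_id continuous_const))).intervalIntegrable _ _
      · exact (hφ.mul (kdv_cc S.cy continuous_id continuous_const)).intervalIntegrable _ _
    rw [e2]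
    refine (norm_sub_le _ _).trans ?_
    rw [norm_mul, kdvE_norm, one_mul]
    calc _ ≤ L * √L * (2 * M) + L * √L * M := by
          apply add_le_add
          · refine (spφ _ (cyn T)).trans ?_
            gcongr; exact ny T ⟨hT.le, le_rfl⟩
          · refine (spφ _ (cyn 0)).trans ?_
            gcongr
      _ = _ := by ring
  have tb : ∀ (θ : ℝ → ℂ) (B : ℝ), (∀ t ∈ Icc 0 T, ‖∫ ξ in x..L, θ ξ * (y ξ t : ℂ)‖ ≤ B) →
      ‖∫ t in (0:ℝ)..T, kdvE w t * ∫ ξ in x..L, θ ξ * (y ξ t : ℂ)‖ ≤ B * T := by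
    intro θ B hB
    have := intervalIntegral.norm_integral_le_of_norm_le_const (a := 0) (b := T) (C := B)
      (f := fun t => kdvE w t * ∫ ξ in x..L, θ ξ * (y ξ t : ℂ)) ?_
    · rwa [sub_zero, abs_of_pos hT] at this
    · intro t ht
      rw [uIoc_of_le hT.le] at ht
      rw [norm_mul, kdvE_norm, one_mul]
      exact hB t ⟨ht.1.le, ht.2⟩
  have t3 := tb φ (L * √L * (2 * M)) (by
    intro t ht
    refine (spφ _ (cyn t)).trans ?_
    gcongr; exact ny t ht)
  have t4 := tb (fun _ => 1) (√L * (2 * M)) (by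
    intro t ht
    have := sp1 _ (cyn t)
    simp only [Complex.ofReal_one, one_mul] at this ⊢
    refine this.trans ?_
    gcongr; exact ny t ht)
  have t5 : ‖kdvHat T w (y L)‖ ≤ √T * (3 * M) := by
    have cyL : Continuous (y L) := kdv_c2 S.cy continuous_const continuous_id
    calc ‖kdvHat T w (y L)‖ ≤ ∫ t in (0:ℝ)..T, |y L t| := by
          apply intervalIntegral.norm_integral_le_of_norm_le hT.le _
            (cyL.abs.intervalIntegrable _ _)
          filter_upwards with t _
          rw [norm_mul, kdvE_norm, one_mul, Complex.norm_real, Real.norm_eq_abs]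
      _ ≤ |∫ t in (0:ℝ)..T, 1 * abs (y L t)| := by simp only [one_mul]; exact le_abs_self _
      _ ≤ _ := kdv_cs_real (fun _ => 1) (fun t => |y L t|) continuous_const cyL.abs 0 T hT.le
      _ ≤ √T * (3 * M) := by
          simp only [sq_abs]
          simp only [one_pow, intervalIntegral.integral_const, sub_zero, smul_eq_mul, mul_one]
          gcongr
          rw [Real.sqrt_le_left (by positivity)]
          nlinarith
  have hw' : ‖Complex.I * (w:ℂ)‖ ≤ 6 := by simpa using hw
  have hLx : ‖((L:ℂ) - x)‖ ≤ L := by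
    rw [← Complex.ofReal_sub, Complex.norm_real, Real.norm_eq_abs, abs_le]
    constructor <;> linarith [hx.1, hx.2]
  rw [← eq_sub_iff_add_eq] at h
  rw [h]
  calc _ ≤ ‖∫ t in (0:ℝ)..T, kdvE w t * ∫ ξ in x..L, φ ξ * (f ξ t : ℂ)‖
        + ‖∫ ξ in x..L, φ ξ * (kdvE w T * (y ξ T : ℂ) - (y ξ 0 : ℂ))‖
        + ‖Complex.I * w * (∫ t in (0:ℝ)..T, kdvE w t * ∫ ξ in x..L, φ ξ * (y ξ t : ℂ))‖
        + ‖∫ t in (0:ℝ)..T, kdvE w t * ∫ ξ in x..L, (fun _ => (1:ℂ)) ξ * (y ξ t : ℂ)‖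
        + ‖((L:ℂ) - x) * kdvHat T w (y L)‖ := by
        refine (norm_sub_le _ _).trans (add_le_add_left ?_ _)
        refine (norm_add_le _ _).trans (add_le_add_left ?_ _)
        refine (norm_sub_le _ _).trans (add_le_add_left ?_ _)
        exact norm_sub_le _ _
    _ ≤ L * √L * M + L * √L * (3 * M) + 6 * (L * √L * (2 * M) * T) + √L * (2 * M) * T
        + L * (√T * (3 * M)) := by
        rw [norm_mul (Complex.I * (w:ℂ)), norm_mul ((L:ℂ) - x)]
        gcongr
    _ = _ := by ring


lemma kdv_alg (l0 lp lm v v1 v2 : ℂ) (m r s : ℝ) (hsum : l0 + lp + lm = 0)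
    (hp : ‖lp‖ = m) (hm : ‖lm‖ = m) (h0p : ‖l0 - lp‖ = s) (h0m : ‖l0 - lm‖ = s)
    (hr : lp - lm = (r : ℂ)) (hr0 : 0 < r) (hmr : m ≤ r) (hs : 0 < s) :
    s * ‖v1‖ ≤ 2 * ‖v2 + l0 * v1 + (l0 ^ 2 + 1) * v‖ + ‖v2 + lp * v1 + (lp ^ 2 + 1) * v‖
      + ‖v2 + lm * v1 + (lm ^ 2 + 1) * v‖ := by
  set a0 := v2 + l0 * v1 + (l0 ^ 2 + 1) * v with ha0
  set ap := v2 + lp * v1 + (lp ^ 2 + 1) * v with hap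
  set am := v2 + lm * v1 + (lm ^ 2 + 1) * v with ham
  have e : (r : ℂ) * (l0 - lp) * (l0 - lm) * v1
      = lp * (l0 - lm) * (a0 - ap) - lm * (l0 - lp) * (a0 - am) := by
    rw [← hr, ha0, hap, ham]
    have : l0 = -lp - lm := by linear_combination hsum
    rw [this]; ring
  have h1 : r * s * s * ‖v1‖ ≤ m * s * (‖a0‖ + ‖ap‖) + m * s * (‖a0‖ + ‖am‖) := by
    calc r * s * s * ‖v1‖ = ‖(r : ℂ) * (l0 - lp) * (l0 - lm) * v1‖ := by
          rw [norm_mul, norm_mul, norm_mul, h0p, h0m, Complex.norm_real, Real.norm_of_nonneg hr0.le]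
      _ ≤ ‖lp * (l0 - lm) * (a0 - ap)‖ + ‖lm * (l0 - lp) * (a0 - am)‖ := by
          rw [e]; exact norm_sub_le _ _
      _ ≤ _ := by
          rw [norm_mul, norm_mul, norm_mul, norm_mul, h0p, h0m, hp, hm]
          have hm0 : 0 ≤ m := hp ▸ norm_nonneg _
          gcongr <;> exact norm_sub_le _ _
  have h2 : r * s * (s * ‖v1‖) ≤ r * s * (2 * ‖a0‖ + ‖ap‖ + ‖am‖) := by
    have : m * s * (2 * ‖a0‖ + ‖ap‖ + ‖am‖) ≤ r * s * (2 * ‖a0‖ + ‖ap‖ + ‖am‖) := by gcongr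
    nlinarith
  exact le_of_mul_le_mul_left h2 (by positivity)

lemma kdv_roots (κ : ℝ) (hκ : 2 ≤ |κ|) : ∃ (l0 lp lm : ℂ) (m r s : ℝ),
    l0 = Complex.I * κ ∧
    l0 * (l0 ^ 2 + 1) = -(Complex.I * (κ ^ 3 - κ : ℝ)) ∧
    lp * (lp ^ 2 + 1) = -(Complex.I * (κ ^ 3 - κ : ℝ)) ∧
    lm * (lm ^ 2 + 1) = -(Complex.I * (κ ^ 3 - κ : ℝ)) ∧
    l0 + lp + lm = 0 ∧ ‖lp‖ = m ∧ ‖lm‖ = m ∧ ‖l0 - lp‖ = s ∧ ‖l0 - lm‖ = s ∧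
    lp - lm = (r : ℂ) ∧ 0 < r ∧ m ≤ r ∧ 1 ≤ s ∧ s = √(3 * κ ^ 2 - 1) ∧
    |κ| / 2 ≤ lp.re ∧ lm.re ≤ -(|κ| / 2) ∧ ‖lp ^ 2 + 1‖ ≤ κ ^ 2 := by
  have hκ2 : 4 ≤ κ ^ 2 := by rw [← sq_abs]; nlinarith
  set r := √(3 * κ ^ 2 - 4) with hr
  have hr2 : r ^ 2 = 3 * κ ^ 2 - 4 := Real.sq_sqrt (by linarith)
  have hr2c : (r : ℂ) ^ 2 = 3 * (κ : ℂ) ^ 2 - 4 := by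
    have := congrArg (fun z : ℝ => (z : ℂ)) hr2
    push_cast at this; exact this
  have hr0 : 0 < r := Real.sqrt_pos.2 (by linarith)
  have hI : Complex.I ^ 2 = -1 := Complex.I_sq
  have hI3 : Complex.I ^ 3 = -Complex.I := by rw [pow_succ, hI]; ring
  have nrm : ∀ (a b c : ℝ), a ^ 2 + b ^ 2 = c → ‖(a : ℂ) + b * Complex.I‖ = √c := by
    intro a b c h
    rw [Complex.norm_add_mul_I, h]
  have hlp : ‖(-(Complex.I * κ) + r) / 2‖ = √(κ ^ 2 - 1) := by
    rw [← nrm (r / 2) (-κ / 2) _ (by nlinarith)]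
    congr 1; push_cast; ring
  refine ⟨Complex.I * κ, (-(Complex.I * κ) + r) / 2, (-(Complex.I * κ) - r) / 2,
    √(κ ^ 2 - 1), r, √(3 * κ ^ 2 - 1), rfl, ?_, ?_, ?_, by ring, hlp, ?_, ?_, ?_, by ring, hr0,
    ?_, ?_, rfl, ?_, ?_, ?_⟩
  · push_cast; linear_combination Complex.I * (κ:ℂ) ^ 3 * hI
  · push_cast
    linear_combination ((r:ℂ) / 8 - 3 * Complex.I * κ / 8) * hr2c
      + (-Complex.I * (κ:ℂ)^3/8 + 3 * r * (κ:ℂ)^2/8) * hI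
  · push_cast
    linear_combination (-(r:ℂ) / 8 - 3 * Complex.I * κ / 8) * hr2c
      + (-Complex.I * (κ:ℂ)^3/8 - 3 * r * (κ:ℂ)^2/8) * hI
  · rw [← nrm (-r / 2) (-κ / 2) _ (by nlinarith)]
    congr 1; push_cast; ring
  · rw [← nrm (-r / 2) (3 * κ / 2) _ (by nlinarith)]
    congr 1; push_cast; ring
  · rw [← nrm (r / 2) (3 * κ / 2) _ (by nlinarith)]
    congr 1; push_cast; ring
  · apply Real.sqrt_le_sqrt; linarith
  · rw [Real.one_le_sqrt]; linarith
  · have : |κ| ≤ r := by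
      apply Real.le_sqrt_of_sq_le; rw [sq_abs]; linarith
    have e : ((-(Complex.I * κ) + r) / 2).re = r / 2 := by simp
    rw [e]; linarith
  · have : |κ| ≤ r := by
      apply Real.le_sqrt_of_sq_le; rw [sq_abs]; linarith
    have e : ((-(Complex.I * κ) - r) / 2).re = -r / 2 := by simp
    rw [e]; linarith
  · refine (norm_add_le _ _).trans ?_
    rw [norm_pow, hlp, Real.sq_sqrt (by linarith), norm_one]; linarith

noncomputable def kdvQ0 (x κ : ℝ) (g : ℝ → ℝ) : ℝ :=
  ‖∫ ξ in (0:ℝ)..x, Complex.exp (-(Complex.I * κ * ξ)) * (g ξ : ℂ)‖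

noncomputable def kdvQ1 (L x κ : ℝ) (g : ℝ → ℝ) : ℝ :=
  ∫ ξ in (0:ℝ)..L, Real.exp (-(|κ| * |x - ξ| / 2)) * |g ξ|

noncomputable def kdvD (T : ℝ) (f y : ℝ → ℝ → ℝ) (Q : (ℝ → ℝ) → ℝ) : ℝ :=
  (∫ t in (0:ℝ)..T, Q (fun ξ => f ξ t)) + Q (fun ξ => y ξ T) + Q (fun ξ => y ξ 0)

lemma kdvQ0_cont (x : ℝ) {f : ℝ → ℝ → ℝ} (hf : Continuous (Function.uncurry f)) :
    Continuous (Function.uncurry fun κ t => kdvQ0 x κ (fun ξ => f ξ t)) := by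
  unfold kdvQ0
  simp only [Function.uncurry_def]
  apply Continuous.norm
  apply intervalIntegral.continuous_parametric_intervalIntegral_of_continuous'
  refine Continuous.mul (by fun_prop) (kdv_cc hf continuous_snd (by fun_prop))

lemma kdvQ1_cont (L x : ℝ) {f : ℝ → ℝ → ℝ} (hf : Continuous (Function.uncurry f)) :
    Continuous (Function.uncurry fun κ t => kdvQ1 L x κ (fun ξ => f ξ t)) := by
  unfold kdvQ1
  simp only [Function.uncurry_def]
  apply intervalIntegral.continuous_parametric_intervalIntegral_of_continuous'
  refine Continuous.mul (by fun_prop) (kdv_c2 hf continuous_snd (by fun_prop)).abs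

lemma kdvQ1_bound (L κ x0 c b : ℝ) (l : ℂ) (hc : 0 ≤ c) (hcb : c ≤ b) (hb : b ≤ L)
    (h : ∀ ξ ∈ Icc c b, -(|κ| * |x0 - ξ| / 2) ≥ l.re * (x0 - ξ)) (g : ℝ → ℝ) (hg : Continuous g) :
    ‖∫ ξ in c..b, Complex.exp (l * (x0 - ξ)) * (g ξ : ℂ)‖ ≤ kdvQ1 L x0 κ g := by
  have hcont : Continuous fun ξ => Real.exp (-(|κ| * |x0 - ξ| / 2)) * |g ξ| :=
    Continuous.mul (by fun_prop) hg.abs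
  calc _ ≤ ∫ ξ in c..b, Real.exp (-(|κ| * |x0 - ξ| / 2)) * |g ξ| := by
        apply intervalIntegral.norm_integral_le_of_norm_le hcb _ (hcont.intervalIntegrable _ _)
        filter_upwards with ξ hξ
        rw [norm_mul, Complex.norm_real, Real.norm_eq_abs, Complex.norm_exp]
        have e : (l * ((x0:ℂ) - ξ)).re = l.re * (x0 - ξ) := by
          rw [← Complex.ofReal_sub, Complex.re_mul_ofReal]
        rw [e]
        gcongr
        exact h ξ ⟨hξ.1.le, hξ.2⟩
    _ ≤ _ := by
        apply intervalIntegral.integral_mono_interval hc hcb hb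
        · filter_upwards with s; positivity
        · exact hcont.intervalIntegrable _ _

lemma kdv_exp_dec {L κ : ℝ} (hL : 0 < L) : κ ^ 2 * Real.exp (-(|κ| * L / 2)) ≤ 8 / L ^ 2 := by
  have h := Real.quadratic_le_exp_of_nonneg (x := |κ| * L / 2) (by positivity)
  rw [Real.exp_neg, ← div_eq_mul_inv, div_le_div_iff₀ (Real.exp_pos _) (by positivity)]
  have : (|κ| * L / 2) ^ 2 = κ ^ 2 * L ^ 2 / 4 := by rw [div_pow, mul_pow, sq_abs]; ring
  have h0 : 0 ≤ |κ| * L / 2 := by positivity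
  nlinarith

set_option maxHeartbeats 400000 in
/-- High frequency bound. -/
lemma kdv_high {L T : ℝ} (hL : 0 < L) (hT : 0 < T) {f y yt yx yxx yxxx : ℝ → ℝ → ℝ}
    (S : KdvSol L T f y yt yx yxx yxxx) (κ : ℝ) (hκ : 2 ≤ |κ|) (x : ℝ) (hx : x ∈ Icc 0 L) :
    √(3 * κ ^ 2 - 1) * ‖kdvHat T (κ ^ 3 - κ) (yx x)‖
      ≤ (40 / L ^ 2) * (√(3 * κ ^ 2 - 1) * ‖kdvHat T (κ ^ 3 - κ) (y L)‖)
        + 6 * (√(3 * κ ^ 2 - 1) * ‖kdvHat T (κ ^ 3 - κ) (yx 0)‖)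
        + 5 * kdvD T f y (kdvQ1 L 0 κ) + 2 * kdvD T f y (kdvQ1 L x κ)
        + 2 * kdvD T f y (kdvQ0 x κ) + 2 * kdvD T f y (kdvQ0 L κ) := by
  obtain ⟨l0, lp, lm, m, r, s, h0, e0, ep, em, hsum, np, nm, n0p, n0m, hr, hr0, hmr, hs1, hs, rp, rm,
    hpk⟩ := kdv_roots κ hκ
  rw [← hs]
  have hκ2 : 4 ≤ κ ^ 2 := by rw [← sq_abs]; nlinarith
  set w := κ ^ 3 - κ with hw
  set v : ℝ → ℂ := fun x => kdvHat T w (y x) with hv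
  set v1 : ℝ → ℂ := fun x => kdvHat T w (yx x) with hv1
  set v2 : ℝ → ℂ := fun x => kdvHat T w (yxx x) with hv2
  set a : ℂ → ℝ → ℂ := fun l x => v2 x + l * v1 x + (l ^ 2 + 1) * v x with ha
  have c0 : ∀ z, Continuous fun t => kdvQ0 z κ (fun ξ => f ξ t) := fun z =>
    kdv_c2 (kdvQ0_cont z S.cf) continuous_const continuous_id
  have c1 : ∀ z, Continuous fun t => kdvQ1 L z κ (fun ξ => f ξ t) := fun z =>
    kdv_c2 (kdvQ1_cont L z S.cf) continuous_const continuous_id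
  have vz : v 0 = 0 := by simp [hv, kdvHat, S.b0]
  have v1L : v1 L = 0 := by simp [hv1, kdvHat, S.b1]
  have v2L : v2 L = 0 := by simp [hv2, kdvHat, S.b2]
  have aL : ∀ l, a l L = (l ^ 2 + 1) * v L := by intro l; simp [ha, v1L, v2L]
  -- oscillatory mode
  have A0 : ∀ z ∈ Icc 0 L, ‖a l0 z‖ ≤ ‖a l0 0‖ + kdvD T f y (kdvQ0 z κ) := by
    intro z hz
    have h := kdv_mode_bound hT S w l0 e0 0 0 z le_rfl hz.1 hz.2 (kdvQ0 z κ) (c0 z) (by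
      intro g _
      rw [kdvQ0]
      apply le_of_eq; congr 2; ext ξ
      rw [h0]; congr 2; push_cast; ring)
    change ‖_ * a l0 z - _ * a l0 0‖ ≤ kdvD T f y (kdvQ0 z κ) at h
    have n1 : ∀ u : ℝ, ‖Complex.exp (l0 * (((0:ℝ):ℂ) - u))‖ = 1 := by
      intro u; rw [Complex.norm_exp, h0]; simp
    have h2 := norm_sub_norm_le (Complex.exp (l0 * (((0:ℝ):ℂ) - z)) * a l0 z)
      (Complex.exp (l0 * (((0:ℝ):ℂ) - ((0:ℝ):ℂ))) * a l0 0)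
    rw [norm_mul, norm_mul, n1, n1, one_mul, one_mul] at h2
    linarith
  -- growing mode
  have Pp : ∀ z ∈ Icc 0 L, ‖a lp z‖ ≤ Real.exp (-(|κ| * (L - z) / 2)) * ‖a lp L‖
      + kdvD T f y (kdvQ1 L z κ) := by
    intro z hz
    have h := kdv_mode_bound hT S w lp ep z z L hz.1 hz.2 le_rfl (kdvQ1 L z κ) (c1 z) (by
      intro g hg
      apply kdvQ1_bound L κ z z L lp hz.1 hz.2 le_rfl _ g hg
      intro ξ hξ
      rw [abs_of_nonpos (a := z - ξ) (by linarith [hξ.1])]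
      nlinarith [hξ.1])
    change ‖_ * a lp L - _ * a lp z‖ ≤ kdvD T f y (kdvQ1 L z κ) at h
    have h2 := norm_sub_norm_le (Complex.exp (lp * ((z:ℂ) - z)) * a lp z)
      (Complex.exp (lp * ((z:ℂ) - L)) * a lp L)
    rw [norm_sub_rev, sub_self, mul_zero, Complex.exp_zero, one_mul, norm_mul] at h2
    rw [sub_self, mul_zero, Complex.exp_zero, one_mul] at h
    have h3 : ‖Complex.exp (lp * ((z:ℂ) - L))‖ ≤ Real.exp (-(|κ| * (L - z) / 2)) := by
      rw [Complex.norm_exp, ← Complex.ofReal_sub, Complex.re_mul_ofReal]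
      apply Real.exp_le_exp.2
      nlinarith [hz.2]
    have h4 := mul_le_mul_of_nonneg_right h3 (norm_nonneg (a lp L))
    linarith
  have Pm : ‖a lm x‖ ≤ ‖a lm 0‖ + kdvD T f y (kdvQ1 L x κ) := by
    have h := kdv_mode_bound hT S w lm em x 0 x le_rfl hx.1 hx.2 (kdvQ1 L x κ) (c1 x) (by
      intro g hg
      apply kdvQ1_bound L κ x 0 x lm le_rfl hx.1 hx.2 _ g hg
      intro ξ hξ
      rw [abs_of_nonneg (a := x - ξ) (by linarith [hξ.2])]
      nlinarith [hξ.2])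
    change ‖_ * a lm x - _ * a lm 0‖ ≤ kdvD T f y (kdvQ1 L x κ) at h
    have h2 := norm_sub_norm_le (Complex.exp (lm * ((x:ℂ) - x)) * a lm x)
      (Complex.exp (lm * ((x:ℂ) - ((0:ℝ):ℂ))) * a lm 0)
    rw [sub_self, mul_zero, Complex.exp_zero, one_mul, norm_mul] at h2
    rw [sub_self, mul_zero, Complex.exp_zero, one_mul] at h
    have h3 : ‖Complex.exp (lm * ((x:ℂ) - ((0:ℝ):ℂ)))‖ ≤ 1 := by
      rw [Complex.norm_exp, ← Complex.ofReal_sub, Complex.re_mul_ofReal]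
      apply Real.exp_le_one_iff.2
      nlinarith [hx.1, abs_nonneg κ]
    have h4 := mul_le_mul_of_nonneg_right h3 (norm_nonneg (a lm 0))
    linarith
  have B1 : ‖a lp 0‖ ≤ (8 / L ^ 2) * (s * ‖v L‖) + kdvD T f y (kdvQ1 L 0 κ) := by
    have h := Pp 0 ⟨le_rfl, hL.le⟩
    rw [aL, norm_mul, sub_zero] at h
    have h2 : Real.exp (-(|κ| * L / 2)) * (‖lp ^ 2 + 1‖ * ‖v L‖) ≤ (8 / L ^ 2) * (s * ‖v L‖) := by
      calc Real.exp (-(|κ| * L / 2)) * (‖lp ^ 2 + 1‖ * ‖v L‖)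
          ≤ Real.exp (-(|κ| * L / 2)) * (κ ^ 2 * ‖v L‖) := by gcongr
        _ = (κ ^ 2 * Real.exp (-(|κ| * L / 2))) * (1 * ‖v L‖) := by ring
        _ ≤ _ := by gcongr; exact kdv_exp_dec hL
    linarith
  have B2 : ‖a l0 0‖ ≤ ‖a lp 0‖ + s * ‖v1 0‖ := by
    have e : a l0 0 = a lp 0 + (l0 - lp) * v1 0 := by simp [ha, vz]; ring
    rw [e, ← n0p, ← norm_mul]; exact norm_add_le _ _
  have B3 : ‖a lm 0‖ ≤ ‖a l0 0‖ + s * ‖v1 0‖ := by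
    have e : a lm 0 = a l0 0 - (l0 - lm) * v1 0 := by simp [ha, vz]; ring
    rw [e, ← n0m, ← norm_mul]; exact norm_sub_le _ _
  have B4 : ‖a lp L‖ ≤ 2 * ‖a l0 L‖ := by
    rw [aL, aL, norm_mul, norm_mul, ← mul_assoc]
    gcongr
    have e : l0 ^ 2 + 1 = ((1 - κ ^ 2 : ℝ) : ℂ) := by
      rw [h0, mul_pow, Complex.I_sq]; push_cast; ring
    rw [e, Complex.norm_real, Real.norm_of_nonpos (by linarith)]
    linarith
  have B5 : ‖a lp x‖ ≤ ‖a lp L‖ + kdvD T f y (kdvQ1 L x κ) := by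
    have h := Pp x hx
    have h3 : Real.exp (-(|κ| * (L - x) / 2)) ≤ 1 := by
      apply Real.exp_le_one_iff.2
      nlinarith [mul_nonneg (abs_nonneg κ) (sub_nonneg.2 hx.2)]
    have h4 := mul_le_mul_of_nonneg_right h3 (norm_nonneg (a lp L))
    linarith
  have K := kdv_alg l0 lp lm (v x) (v1 x) (v2 x) m r s hsum np nm n0p n0m hr hr0 hmr (by linarith)
  change s * ‖v1 x‖ ≤ 2 * ‖a l0 x‖ + ‖a lp x‖ + ‖a lm x‖ at K
  have A0x := A0 x hx
  have A0L := A0 L ⟨hL.le, le_rfl⟩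
  change s * ‖v1 x‖ ≤ (40 / L ^ 2) * (s * ‖v L‖) + 6 * (s * ‖v1 0‖) + _ + _ + _ + _
  have e40 : (40 / L ^ 2) * (s * ‖v L‖) = 5 * ((8 / L ^ 2) * (s * ‖v L‖)) := by ring
  rw [e40]
  linarith


def kdvL2 (M : ℝ) (S : Set ℝ) (h : ℝ → ℝ) (A : ℝ) : Prop :=
  Measurable h ∧ 0 ≤ A ∧ ∫⁻ κ in S, ENNReal.ofReal (h κ ^ 2) ≤ ENNReal.ofReal (A * M ^ 2)

lemma kdvL2.add {M : ℝ} {S : Set ℝ} {h g : ℝ → ℝ} {A B : ℝ} (hh : kdvL2 M S h A)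
    (hg : kdvL2 M S g B) : kdvL2 M S (fun κ => h κ + g κ) (2 * A + 2 * B) := by
  obtain ⟨mh, hA, ih⟩ := hh
  obtain ⟨mg, hB, ig⟩ := hg
  refine ⟨mh.add mg, by positivity, ?_⟩
  have m1 : Measurable fun κ => ENNReal.ofReal (h κ ^ 2) := (mh.pow_const 2).ennreal_ofReal
  have m2 : Measurable fun κ => ENNReal.ofReal (g κ ^ 2) := (mg.pow_const 2).ennreal_ofReal
  calc ∫⁻ κ in S, ENNReal.ofReal ((h κ + g κ) ^ 2)
      ≤ ∫⁻ κ in S, (2 * ENNReal.ofReal (h κ ^ 2) + 2 * ENNReal.ofReal (g κ ^ 2)) := by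
        apply lintegral_mono
        intro κ
        have e2 : (2 : ENNReal) = ENNReal.ofReal 2 := by simp
        dsimp only
        rw [e2, ← ENNReal.ofReal_mul zero_le_two, ← ENNReal.ofReal_mul zero_le_two,
          ← ENNReal.ofReal_add (by positivity) (by positivity)]
        apply ENNReal.ofReal_le_ofReal
        nlinarith [sq_nonneg (h κ - g κ)]
    _ = 2 * (∫⁻ κ in S, ENNReal.ofReal (h κ ^ 2)) + 2 * ∫⁻ κ in S, ENNReal.ofReal (g κ ^ 2) := by
        rw [lintegral_add_left (m1.const_mul 2), lintegral_const_mul _ m1, lintegral_const_mul _ m2]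
    _ ≤ 2 * ENNReal.ofReal (A * M ^ 2) + 2 * ENNReal.ofReal (B * M ^ 2) := by gcongr
    _ = _ := by
        have e2 : (2 : ENNReal) = ENNReal.ofReal 2 := by simp
        rw [e2, ← ENNReal.ofReal_mul zero_le_two, ← ENNReal.ofReal_mul zero_le_two,
          ← ENNReal.ofReal_add (by positivity) (by positivity)]
        congr 1; ring

lemma kdvL2.smul {M : ℝ} {S : Set ℝ} {h : ℝ → ℝ} {A : ℝ} (hh : kdvL2 M S h A) (c : ℝ) :
    kdvL2 M S (fun κ => c * h κ) (c ^ 2 * A) := by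
  obtain ⟨mh, hA, ih⟩ := hh
  refine ⟨mh.const_mul c, by positivity, ?_⟩
  have m1 : Measurable fun κ => ENNReal.ofReal (h κ ^ 2) := (mh.pow_const 2).ennreal_ofReal
  simp_rw [mul_pow, ENNReal.ofReal_mul (sq_nonneg c)]
  rw [lintegral_const_mul _ m1, mul_assoc, ENNReal.ofReal_mul (sq_nonneg c)]
  gcongr

lemma kdvL2.mono {M : ℝ} {S S' : Set ℝ} {h : ℝ → ℝ} {A : ℝ} (hh : kdvL2 M S h A) (hS : S' ⊆ S) :
    kdvL2 M S' h A :=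
  ⟨hh.1, hh.2.1, (lintegral_mono_set hS).trans hh.2.2⟩

lemma kdvD_L2 {L T : ℝ} (hL : 0 < L) (hT : 0 < T) {f y yt yx yxx yxxx : ℝ → ℝ → ℝ}
    (S : KdvSol L T f y yt yx yxx yxxx) (Q : ℝ → (ℝ → ℝ) → ℝ) (K : ℝ) (hK0 : 0 ≤ K)
    (hc : ∀ g : ℝ → ℝ → ℝ, Continuous (Function.uncurry g) →
      Continuous (Function.uncurry fun κ t => Q κ (fun ξ => g ξ t)))
    (hpos : ∀ κ g, 0 ≤ Q κ g)
    (hK : ∀ g : ℝ → ℝ, Continuous g →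
      ∫⁻ κ, ENNReal.ofReal (Q κ g ^ 2) ≤ ENNReal.ofReal (K * ∫ ξ in (0:ℝ)..L, g ξ ^ 2)) :
    kdvL2 (kdvM L T f y) univ (fun κ => kdvD T f y (Q κ)) (2 * (2 * K + 2 * (4 * K)) + 2 * (4 * K)) := by
  obtain ⟨hE1, -, -⟩ := kdv_energy hL hT S
  set M := kdvM L T f y with hM
  have hM0 : 0 ≤ M := kdvM_nonneg hT f y
  have cyn : ∀ t, Continuous fun ξ => y ξ t := fun t => kdv_c2 S.cy continuous_id continuous_const
  have cfn : ∀ t, Continuous fun ξ => f ξ t := fun t => kdv_c2 S.cf continuous_id continuous_const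
  have nf : ∫ t in (0:ℝ)..T, √(∫ x in (0:ℝ)..L, f x t ^ 2) ≤ M := by
    rw [hM, kdvM]; linarith [Real.sqrt_nonneg (∫ x in (0:ℝ)..L, y x 0 ^ 2)]
  have nf0 : 0 ≤ ∫ t in (0:ℝ)..T, √(∫ x in (0:ℝ)..L, f x t ^ 2) :=
    intervalIntegral.integral_nonneg hT.le (fun t _ => Real.sqrt_nonneg _)
  have hy : ∀ t ∈ Icc 0 T, kdvL2 M univ (fun κ => Q κ (fun ξ => y ξ t)) (4 * K) := by
    intro t ht
    refine ⟨(kdv_c2 (hc y S.cy) continuous_id continuous_const).measurable, by positivity, ?_⟩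
    rw [Measure.restrict_univ]
    refine (hK _ (cyn t)).trans (ENNReal.ofReal_le_ofReal ?_)
    have := mul_le_mul_of_nonneg_left (hE1 t ht) hK0
    linarith
  have hf : kdvL2 M univ (fun κ => ∫ t in (0:ℝ)..T, Q κ (fun ξ => f ξ t)) K := by
    refine ⟨?_, hK0, ?_⟩
    · apply Continuous.measurable
      apply intervalIntegral.continuous_parametric_intervalIntegral_of_continuous'
      exact hc f S.cf
    · rw [Measure.restrict_univ]
      have := kdv_minkowski T hT (fun κ t => Q κ (fun ξ => f ξ t)) (hc f S.cf)
        (fun κ t => hpos _ _) (fun t => √K * √(∫ x in (0:ℝ)..L, f x t ^ 2))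
        (continuous_const.mul (kdv_cont_norm L f S.cf)) (fun t => by positivity) (by
          intro t
          refine (hK _ (cfn t)).trans (le_of_eq ?_)
          rw [mul_pow, Real.sq_sqrt hK0, Real.sq_sqrt]
          exact intervalIntegral.integral_nonneg hL.le (fun x _ => sq_nonneg _))
      refine this.trans (ENNReal.ofReal_le_ofReal ?_)
      rw [intervalIntegral.integral_const_mul, mul_pow, Real.sq_sqrt hK0]
      gcongr
  exact (hf.add (hy T ⟨hT.le, le_rfl⟩)).add (hy 0 ⟨le_rfl, hT.le⟩)

lemma kdvQ0_L2 {L x : ℝ} (hx : x ∈ Icc 0 L) (g : ℝ → ℝ) (hg : Continuous g) :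
    ∫⁻ κ, ENNReal.ofReal (kdvQ0 x κ g ^ 2)
      ≤ ENNReal.ofReal ((2 * Real.pi) * ∫ ξ in (0:ℝ)..L, g ξ ^ 2) := by
  rcases hx.1.eq_or_lt with h | h
  · subst h; simp [kdvQ0]
  · unfold kdvQ0
    rw [kdv_plancherel g hg 0 x h]
    apply ENNReal.ofReal_le_ofReal
    gcongr
    apply intervalIntegral.integral_mono_interval le_rfl hx.1 hx.2
    · filter_upwards with s; positivity
    · exact (hg.pow 2).intervalIntegrable _ _

def kdvS : Set ℝ := {κ | 2 ≤ |κ|}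

lemma kdvS_meas : MeasurableSet kdvS := measurableSet_le measurable_const measurable_id.abs

lemma kdv_cov (g : ℝ → ENNReal) : ∫⁻ w in (fun κ : ℝ => κ ^ 3 - κ) '' kdvS, g w
    = ∫⁻ κ in kdvS, ENNReal.ofReal (3 * κ ^ 2 - 1) * g (κ ^ 3 - κ) := by
  rw [lintegral_image_eq_lintegral_abs_deriv_mul (f' := fun κ => 3 * κ ^ 2 - 1) kdvS_meas]
  · apply setLIntegral_congr_fun kdvS_meas
    intro κ hκ
    have hκ' : 2 ≤ |κ| := hκ
    have hκ2 : 4 ≤ κ ^ 2 := by rw [← sq_abs]; nlinarith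
    dsimp only
    rw [abs_of_nonneg (by linarith)]
  · intro κ _
    apply HasDerivAt.hasDerivWithinAt
    have := (hasDerivAt_pow 3 κ).sub (hasDerivAt_id κ)
    refine HasDerivAt.congr_deriv (f := fun κ : ℝ => κ ^ 3 - κ) this ?_
    norm_num
  · intro a ha b hb hab
    have ha' : 2 ≤ |a| := ha
    have hb' : 2 ≤ |b| := hb
    have ha2 : 4 ≤ a ^ 2 := by rw [← sq_abs]; nlinarith
    have hb2 : 4 ≤ b ^ 2 := by rw [← sq_abs]; nlinarith
    dsimp only at hab
    have h : (a - b) * (a ^ 2 + a * b + b ^ 2 - 1) = 0 := by linear_combination hab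
    rcases mul_eq_zero.1 h with h | h
    · linarith
    · nlinarith [sq_nonneg (a + b)]

lemma kdv_cover : (univ : Set ℝ) ⊆ Icc (-6) 6 ∪ (fun κ : ℝ => κ ^ 3 - κ) '' kdvS := by
  intro w _
  by_cases hw : w ∈ Icc (-6 : ℝ) 6
  · exact Or.inl hw
  right
  have hcont : Continuous fun κ : ℝ => κ ^ 3 - κ := by fun_prop
  set R := |w| + 2 with hR
  have hR2 : 2 ≤ R := by rw [hR]; linarith [abs_nonneg w]
  have hR3 : |w| ≤ R ^ 3 - R := by nlinarith [abs_nonneg w, mul_self_nonneg R]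
  obtain ⟨k, hk, hk2⟩ := intermediate_value_Icc (a := -R) (b := R) (by linarith)
    hcont.continuousOn (show w ∈ Icc _ _ from
      ⟨by have := neg_abs_le w; nlinarith, (le_abs_self w).trans hR3⟩)
  refine ⟨k, ?_, hk2⟩
  by_contra hc
  have hc' : ¬ (2 ≤ |k|) := hc
  push Not at hc'
  rw [abs_lt] at hc'
  apply hw
  dsimp only at hk2
  rw [← hk2]
  constructor <;> nlinarith [mul_pos (show 0 < k + 2 by linarith) (show 0 < 2 - k by linarith),
    sq_nonneg (k + 1), sq_nonneg (k - 1)]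

lemma kdvHat_cont (T : ℝ) {g : ℝ → ℝ} (hg : Continuous g) : Continuous fun w => kdvHat T w g := by
  unfold kdvHat
  apply intervalIntegral.continuous_parametric_intervalIntegral_of_continuous'
  exact (kdvE_cont).mul (Complex.continuous_ofReal.comp (hg.comp continuous_snd))

lemma kdv_plan' {T : ℝ} (hT : 0 < T) {g : ℝ → ℝ} (hg : Continuous g) :
    ∫⁻ w, ENNReal.ofReal (‖kdvHat T w g‖ ^ 2) = ENNReal.ofReal (2 * Real.pi * ∫ t in (0:ℝ)..T, g t ^ 2) :=
  kdv_plancherel g hg 0 T hT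

lemma kdv_cov' (g : ℝ → ℝ) :
    ∫⁻ κ in kdvS, ENNReal.ofReal ((√(3 * κ ^ 2 - 1) * g (κ ^ 3 - κ)) ^ 2)
      = ∫⁻ w in (fun κ : ℝ => κ ^ 3 - κ) '' kdvS, ENNReal.ofReal (g w ^ 2) := by
  rw [kdv_cov (fun w => ENNReal.ofReal (g w ^ 2))]
  apply setLIntegral_congr_fun kdvS_meas
  intro κ hκ
  have hκ' : 2 ≤ |κ| := hκ
  have hκ2 : 4 ≤ κ ^ 2 := by rw [← sq_abs]; nlinarith
  dsimp only
  rw [mul_pow, Real.sq_sqrt (by linarith), ENNReal.ofReal_mul (by linarith)]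

lemma kdv_trace_L2 {T M : ℝ} (hT : 0 < T) {g : ℝ → ℝ} (hg : Continuous g) (A : ℝ) (hA : 0 ≤ A)
    (h : ∫ t in (0:ℝ)..T, g t ^ 2 ≤ A * M ^ 2) :
    kdvL2 M kdvS (fun κ => √(3 * κ ^ 2 - 1) * ‖kdvHat T (κ ^ 3 - κ) g‖) (2 * Real.pi * A) := by
  refine ⟨?_, by positivity, ?_⟩
  · apply Continuous.measurable
    exact Continuous.mul (by fun_prop)
      ((kdvHat_cont T hg).comp (by fun_prop : Continuous fun κ : ℝ => κ ^ 3 - κ)).norm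
  · rw [kdv_cov' (fun w => ‖kdvHat T w g‖)]
    refine (setLIntegral_le_lintegral _ _).trans ?_
    rw [kdv_plan' hT hg]
    apply ENNReal.ofReal_le_ofReal
    rw [mul_assoc (2 * Real.pi)]
    gcongr

/-- The estimate for globally extended solutions. -/
lemma kdv_main {L T : ℝ} (hL : 0 < L) (hT : 0 < T) : ∃ C : ℝ, 0 ≤ C ∧
    ∀ {f y yt yx yxx yxxx : ℝ → ℝ → ℝ} (_ : KdvSol L T f y yt yx yxx yxxx),
    ∀ x ∈ Icc 0 L, ∫ t in (0:ℝ)..T, yx x t ^ 2 ≤ C * kdvM L T f y ^ 2 := by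
  obtain ⟨C0, hC0, hlow⟩ := kdv_low hL hT
  obtain ⟨K, hK0, hschur⟩ := kdv_schur
  have hpi := Real.pi_pos
  obtain ⟨d0, hd0⟩ : ∃ d, d = 2 * (2 * (2 * Real.pi) + 2 * (4 * (2 * Real.pi))) + 2 * (4 * (2 * Real.pi)) :=
    ⟨_, rfl⟩
  obtain ⟨d1, hd1⟩ : ∃ d, d = 2 * (2 * K + 2 * (4 * K)) + 2 * (4 * K) := ⟨_, rfl⟩
  obtain ⟨B, hB⟩ : ∃ B, B = 2 * (2 * (2 * (2 * (2 * ((40 / L ^ 2) ^ 2 * (2 * Real.pi * 5))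
    + 2 * (6 ^ 2 * (2 * Real.pi * 5))) + 2 * (5 ^ 2 * d1)) + 2 * (2 ^ 2 * d1)) + 2 * (2 ^ 2 * d0))
    + 2 * (2 ^ 2 * d0) := ⟨_, rfl⟩
  have hB0 : 0 ≤ B := by rw [hB, hd0, hd1]; positivity
  refine ⟨(C0 ^ 2 * 12 + B) / (2 * Real.pi), by positivity, ?_⟩
  intro f y yt yx yxx yxxx S x hx
  obtain ⟨-, hE2, hE3⟩ := kdv_energy hL hT S
  have hlo := hlow S
  have hhi := kdv_high hL hT S
  have D0 : ∀ z ∈ Icc 0 L, kdvL2 (kdvM L T f y) kdvS (fun κ => kdvD T f y (kdvQ0 z κ)) d0 := by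
    intro z hz
    rw [hd0]
    exact (kdvD_L2 hL hT S (kdvQ0 z) (2 * Real.pi) (by positivity) (fun g hg => kdvQ0_cont z hg)
      (fun κ g => norm_nonneg _) (fun g hg => kdvQ0_L2 hz g hg)).mono (subset_univ _)
  have D1 : ∀ z, kdvL2 (kdvM L T f y) kdvS (fun κ => kdvD T f y (kdvQ1 L z κ)) d1 := by
    intro z
    rw [hd1]
    exact (kdvD_L2 hL hT S (kdvQ1 L z) K hK0.le (fun g hg => kdvQ1_cont L z hg)
      (fun κ g => intervalIntegral.integral_nonneg hL.le (fun _ _ => by positivity))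
      (fun g hg => hschur L hL g hg z)).mono (subset_univ _)
  have cx : ∀ z, Continuous (yx z) := fun z => kdv_c2 S.cyx continuous_const continuous_id
  have cy : ∀ z, Continuous (y z) := fun z => kdv_c2 S.cy continuous_const continuous_id
  have V := kdv_trace_L2 hT (cy L) 5 (by norm_num) hE2
  have V1 := kdv_trace_L2 hT (cx 0) 5 (by norm_num) hE3
  have tot := (((((V.smul (40 / L ^ 2)).add (V1.smul 6)).add ((D1 0).smul 5)).add
    ((D1 x).smul 2)).add ((D0 x hx).smul 2)).add ((D0 L ⟨hL.le, le_rfl⟩).smul 2)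
  rw [← hB] at tot
  have hM0 : 0 ≤ kdvM L T f y := kdvM_nonneg hT f y
  set M := kdvM L T f y with hM
  have hhigh : ∫⁻ w in (fun κ : ℝ => κ ^ 3 - κ) '' kdvS, ENNReal.ofReal (‖kdvHat T w (yx x)‖ ^ 2)
      ≤ ENNReal.ofReal (B * M ^ 2) := by
    rw [← kdv_cov' (fun w => ‖kdvHat T w (yx x)‖)]
    refine le_trans ?_ tot.2.2
    apply setLIntegral_mono' kdvS_meas
    intro κ hκ
    apply ENNReal.ofReal_le_ofReal
    apply pow_le_pow_left₀ (by positivity)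
    exact hhi κ hκ x hx
  have hlowi : ∫⁻ w in Icc (-6:ℝ) 6, ENNReal.ofReal (‖kdvHat T w (yx x)‖ ^ 2)
      ≤ ENNReal.ofReal ((C0 ^ 2 * 12) * M ^ 2) := by
    calc _ ≤ ∫⁻ w in Icc (-6:ℝ) 6, ENNReal.ofReal ((C0 * M) ^ 2) := by
          apply setLIntegral_mono' measurableSet_Icc
          intro w hw
          apply ENNReal.ofReal_le_ofReal
          apply pow_le_pow_left₀ (norm_nonneg _)
          exact hlo w (abs_le.2 hw) x hx
      _ = _ := by
          rw [setLIntegral_const, Real.volume_Icc, ← ENNReal.ofReal_mul (by positivity)]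
          congr 1; ring
  have fin : ENNReal.ofReal (2 * Real.pi * ∫ t in (0:ℝ)..T, yx x t ^ 2)
      ≤ ENNReal.ofReal ((C0 ^ 2 * 12) * M ^ 2 + B * M ^ 2) := by
    rw [← kdv_plan' hT (cx x), ENNReal.ofReal_add (by positivity) (by positivity)]
    calc _ = ∫⁻ w in univ, ENNReal.ofReal (‖kdvHat T w (yx x)‖ ^ 2) := by rw [Measure.restrict_univ]
      _ ≤ _ := lintegral_mono_set kdv_cover
      _ ≤ _ := lintegral_union_le _ _ _
      _ ≤ _ := add_le_add hlowi hhigh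
  rw [ENNReal.ofReal_le_ofReal_iff (by positivity)] at fin
  rw [div_mul_eq_mul_div, le_div_iff₀ (by positivity)]
  linarith


/-- Clamp to an interval. -/
noncomputable def kdvP (L x : ℝ) : ℝ := max 0 (min L x)

lemma kdvP_cont (L : ℝ) : Continuous (kdvP L) := by unfold kdvP; fun_prop

lemma kdvP_mem {L : ℝ} (hL : 0 < L) (x : ℝ) : kdvP L x ∈ Icc 0 L :=
  ⟨le_max_left _ _, max_le hL.le (min_le_left _ _)⟩

lemma kdvP_eq {L x : ℝ} (hx : x ∈ Icc 0 L) : kdvP L x = x := by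
  unfold kdvP; rw [min_eq_right hx.2, max_eq_right hx.1]

lemma kdvP_ext {L T : ℝ} (hL : 0 < L) (hT : 0 < T) {g : ℝ → ℝ → ℝ}
    (hg : ContinuousOn (fun p : ℝ × ℝ => g p.1 p.2) (Icc 0 L ×ˢ Icc 0 T)) :
    Continuous (Function.uncurry fun x t => g (kdvP L x) (kdvP T t)) := by
  have : Continuous fun p : ℝ × ℝ => (kdvP L p.1, kdvP T p.2) :=
    ((kdvP_cont L).comp continuous_fst).prodMk ((kdvP_cont T).comp continuous_snd)
  exact hg.comp_continuous this (fun p => ⟨kdvP_mem hL _, kdvP_mem hT _⟩)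

lemma kdvP_deriv {L : ℝ} {g : ℝ → ℝ} {d x : ℝ} (hx : x ∈ Ioo 0 L)
    (h : HasDerivAt g d x) : HasDerivAt (fun s => g (kdvP L s)) d x := by
  apply h.congr_of_eventuallyEq
  filter_upwards [Ioo_mem_nhds hx.1 hx.2] with s hs
  rw [kdvP_eq ⟨hs.1.le, hs.2.le⟩]

theorem forward_kdv_hidden_regularity
    (L T : ℝ) (hL : 0 < L) (hT : 0 < T) :
    ∃ C : ℝ, 0 < C ∧
      ∀ (f y yt yx yxx yxxx : ℝ → ℝ → ℝ),
        ContinuousOn (fun p : ℝ × ℝ => f p.1 p.2) (Icc 0 L ×ˢ Icc 0 T) →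
        (∀ x ∈ Icc (0:ℝ) L, ∀ t ∈ Icc (0:ℝ) T,
          HasDerivAt (fun s => y x s) (yt x t) t) →
        (∀ x ∈ Icc (0:ℝ) L, ∀ t ∈ Icc (0:ℝ) T,
          HasDerivAt (fun x' => y x' t) (yx x t) x) →
        (∀ x ∈ Icc (0:ℝ) L, ∀ t ∈ Icc (0:ℝ) T,
          HasDerivAt (fun x' => yx x' t) (yxx x t) x) →
        (∀ x ∈ Icc (0:ℝ) L, ∀ t ∈ Icc (0:ℝ) T,
          HasDerivAt (fun x' => yxx x' t) (yxxx x t) x) →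
        ContinuousOn (fun p : ℝ × ℝ => y p.1 p.2) (Icc 0 L ×ˢ Icc 0 T) →
        ContinuousOn (fun p : ℝ × ℝ => yt p.1 p.2) (Icc 0 L ×ˢ Icc 0 T) →
        ContinuousOn (fun p : ℝ × ℝ => yx p.1 p.2) (Icc 0 L ×ˢ Icc 0 T) →
        ContinuousOn (fun p : ℝ × ℝ => yxx p.1 p.2) (Icc 0 L ×ˢ Icc 0 T) →
        ContinuousOn (fun p : ℝ × ℝ => yxxx p.1 p.2) (Icc 0 L ×ˢ Icc 0 T) →
        (∀ x ∈ Icc (0:ℝ) L, ∀ t ∈ Icc (0:ℝ) T,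
          yt x t + yx x t + yxxx x t = f x t) →
        (∀ t ∈ Icc (0:ℝ) T, y 0 t = 0) →
        (∀ t ∈ Icc (0:ℝ) T, yx L t = 0) →
        (∀ t ∈ Icc (0:ℝ) T, yxx L t = 0) →
          ∀ x ∈ Icc (0:ℝ) L,
            Real.sqrt (∫ t in (0:ℝ)..T, (yx x t) ^ 2)
              ≤ C * (Real.sqrt (∫ x' in (0:ℝ)..L, (y x' 0) ^ 2)
                  + ∫ t in (0:ℝ)..T, Real.sqrt (∫ x' in (0:ℝ)..L, (f x' t) ^ 2)) := by
  obtain ⟨C, hC, hmain⟩ := kdv_main hL hT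
  refine ⟨√C + 1, by positivity, ?_⟩
  intro f y yt yx yxx yxxx cf dt dx dxx dxxx cy cyt cyx cyxx cyxxx pde b0 b1 b2 x hx
  have p0 : kdvP L 0 = 0 := kdvP_eq ⟨le_rfl, hL.le⟩
  have pL : kdvP L L = L := kdvP_eq ⟨hL.le, le_rfl⟩
  have q0 : kdvP T 0 = 0 := kdvP_eq ⟨le_rfl, hT.le⟩
  have S : KdvSol L T (fun x t => f (kdvP L x) (kdvP T t)) (fun x t => y (kdvP L x) (kdvP T t))
      (fun x t => yt (kdvP L x) (kdvP T t)) (fun x t => yx (kdvP L x) (kdvP T t))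
      (fun x t => yxx (kdvP L x) (kdvP T t)) (fun x t => yxxx (kdvP L x) (kdvP T t)) := by
    refine ⟨kdvP_ext hL hT cf, kdvP_ext hL hT cy, kdvP_ext hL hT cyt, kdvP_ext hL hT cyx,
      kdvP_ext hL hT cyxx, kdvP_ext hL hT cyxxx, ?_, ?_, ?_, ?_, ?_, ?_, ?_, ?_⟩
    · intro x t ht
      have ht' : t ∈ Icc 0 T := ⟨ht.1.le, ht.2.le⟩
      rw [kdvP_eq ht']
      exact kdvP_deriv (g := fun s => y (kdvP L x) s) ht (dt _ (kdvP_mem hL x) t ht')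
    · intro x hx t
      have hx' : x ∈ Icc 0 L := ⟨hx.1.le, hx.2.le⟩
      rw [kdvP_eq hx']
      exact kdvP_deriv (g := fun s => y s (kdvP T t)) hx (dx x hx' _ (kdvP_mem hT t))
    · intro x hx t
      have hx' : x ∈ Icc 0 L := ⟨hx.1.le, hx.2.le⟩
      rw [kdvP_eq hx']
      exact kdvP_deriv (g := fun s => yx s (kdvP T t)) hx (dxx x hx' _ (kdvP_mem hT t))
    · intro x hx t
      have hx' : x ∈ Icc 0 L := ⟨hx.1.le, hx.2.le⟩
      rw [kdvP_eq hx']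
      exact kdvP_deriv (g := fun s => yxx s (kdvP T t)) hx (dxxx x hx' _ (kdvP_mem hT t))
    · intro x t
      exact pde _ (kdvP_mem hL x) _ (kdvP_mem hT t)
    · intro t; rw [p0]; exact b0 _ (kdvP_mem hT t)
    · intro t; rw [pL]; exact b1 _ (kdvP_mem hT t)
    · intro t; rw [pL]; exact b2 _ (kdvP_mem hT t)
  have h := hmain S x hx
  have e1 : ∫ t in (0:ℝ)..T, yx (kdvP L x) (kdvP T t) ^ 2 = ∫ t in (0:ℝ)..T, yx x t ^ 2 := by
    apply intervalIntegral.integral_congr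
    intro t ht
    rw [uIcc_of_le hT.le] at ht
    dsimp only
    rw [kdvP_eq hx, kdvP_eq ht]
  have e2 : ∀ (g : ℝ → ℝ → ℝ), ∀ t ∈ Icc 0 T,
      ∫ x in (0:ℝ)..L, g (kdvP L x) (kdvP T t) ^ 2 = ∫ x in (0:ℝ)..L, g x t ^ 2 := by
    intro g t ht
    apply intervalIntegral.integral_congr
    intro x hx
    rw [uIcc_of_le hL.le] at hx
    dsimp only
    rw [kdvP_eq hx, kdvP_eq ht]
  have e3 : kdvM L T (fun x t => f (kdvP L x) (kdvP T t)) (fun x t => y (kdvP L x) (kdvP T t))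
      = √(∫ x' in (0:ℝ)..L, (y x' 0) ^ 2) + ∫ t in (0:ℝ)..T, √(∫ x' in (0:ℝ)..L, (f x' t) ^ 2) := by
    unfold kdvM
    rw [e2 y 0 ⟨le_rfl, hT.le⟩]
    congr 1
    apply intervalIntegral.integral_congr
    intro t ht
    rw [uIcc_of_le hT.le] at ht
    dsimp only
    rw [e2 f t ht]
  have hM0 := kdvM_nonneg (L := L) hT (fun x t => f (kdvP L x) (kdvP T t))
    (fun x t => y (kdvP L x) (kdvP T t))
  rw [e1, e3] at h
  rw [e3] at hM0
  set M := √(∫ x' in (0:ℝ)..L, (y x' 0) ^ 2) + ∫ t in (0:ℝ)..T, √(∫ x' in (0:ℝ)..L, (f x' t) ^ 2)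
  calc √(∫ t in (0:ℝ)..T, yx x t ^ 2) ≤ √(C * M ^ 2) := Real.sqrt_le_sqrt h
    _ = √C * M := by rw [Real.sqrt_mul hC, Real.sqrt_sq hM0]
    _ ≤ (√C + 1) * M := by linarith
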